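/- arXiv:1310.8378 — 4 statements merged into one kernel-verified Lean document; each statement's English description precedes it below -/
import Mathlib

section
/- There is an absolute constant c > 0 such that for every real ε with 0 < ε < 1 there exists K such that for every integer k ≥ K there is a set U of k-permutations with |U| ≥ (1−ε)·k! and liminf_{n→∞} S_n(U)^{1/n} ≥ 2^{c·(k/log₂ k)^{1/4}}. -/
open Filter

/-- A binary matrix `A` contains a binary matrix `P` (as a submatrix pattern):
there are strictly increasing choices of rows and columns such that `A` has a
one wherever `P` does. -/
def ContainsMat {k l m n : ℕ} (P : Fin k → Fin l → Bool) (A : Fin m → Fin n → Bool) : Prop :=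
  ∃ (r : Fin k → Fin m) (c : Fin l → Fin n), StrictMono r ∧ StrictMono c ∧
    ∀ i j, P i j = true → A (r i) (c j) = true

/-- The permutation matrix of a permutation of `{1,…,k}`. -/
def permMatrix {k : ℕ} (π : Equiv.Perm (Fin k)) : Fin k → Fin k → Bool :=
  fun i j => decide (π i = j)

/-- The mass of a binary matrix: the number of its one-entries. -/
def mass {m n : ℕ} (A : Fin m → Fin n → Bool) : ℕ :=
  (Finset.univ.filter fun p : Fin m × Fin n => A p.1 p.2 = true).card

/-- A binary matrix avoids a permutation if it avoids its permutation matrix. -/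
def AvoidsPerm {k m n : ℕ} (A : Fin m → Fin n → Bool) (π : Equiv.Perm (Fin k)) : Prop :=
  ¬ ContainsMat (permMatrix π) A

/-- `ex n π`: the maximum mass of an `n × n` binary matrix avoiding `π`. -/
noncomputable def exP {k : ℕ} (n : ℕ) (π : Equiv.Perm (Fin k)) : ℕ :=
  sSup {m | ∃ A : Fin n → Fin n → Bool, AvoidsPerm A π ∧ mass A = m}

/-- `ex n U` for a set `U` of permutations: the maximum mass of an `n × n`
binary matrix avoiding every permutation in `U`. -/
noncomputable def exU {k : ℕ} (n : ℕ) (U : Finset (Equiv.Perm (Fin k))) : ℕ :=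
  sSup {m | ∃ A : Fin n → Fin n → Bool, (∀ π ∈ U, AvoidsPerm A π) ∧ mass A = m}

/-- An `n`-permutation `σ` contains a `k`-permutation `π`. -/
def PermContains {n k : ℕ} (σ : Equiv.Perm (Fin n)) (π : Equiv.Perm (Fin k)) : Prop :=
  ∃ x : Fin k → Fin n, StrictMono x ∧ ∀ i j, σ (x i) < σ (x j) ↔ π i < π j

/-- `S n π`: the number of `n`-permutations avoiding `π`. -/
noncomputable def SP {k : ℕ} (n : ℕ) (π : Equiv.Perm (Fin k)) : ℕ :=
  Nat.card {σ : Equiv.Perm (Fin n) // ¬ PermContains σ π}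

/-- `S n U`: the number of `n`-permutations avoiding every permutation in `U`. -/
noncomputable def SU {k : ℕ} (n : ℕ) (U : Finset (Equiv.Perm (Fin k))) : ℕ :=
  Nat.card {σ : Equiv.Perm (Fin n) // ∀ π ∈ U, ¬ PermContains σ π}

/-- `T n π`: the number of `n × n` binary matrices avoiding `π`. -/
noncomputable def TP {k : ℕ} (n : ℕ) (π : Equiv.Perm (Fin k)) : ℕ :=
  Nat.card {A : Fin n → Fin n → Bool // AvoidsPerm A π}

/-- `P` is an interval minor of `A`: there are ordered disjoint row intervals
`[rlo a, rhi a]` and column intervals `[clo b, chi b]` such that wherever `P`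
has a one, the corresponding block of `A` contains a one. -/
def IntervalMinor {k l m n : ℕ} (P : Fin k → Fin l → Bool) (A : Fin m → Fin n → Bool) : Prop :=
  ∃ (rlo rhi : Fin k → Fin m) (clo chi : Fin l → Fin n),
    (∀ a, rlo a ≤ rhi a) ∧ (∀ a b, a < b → rhi a < rlo b) ∧
    (∀ a, clo a ≤ chi a) ∧ (∀ a b, a < b → chi a < clo b) ∧
    ∀ a b, P a b = true → ∃ i j, rlo a ≤ i ∧ i ≤ rhi a ∧ clo b ≤ j ∧ j ≤ chi b ∧ A i j = true

/-- The all-ones `k × l` binary matrix. -/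
def J (k l : ℕ) : Fin k → Fin l → Bool := fun _ _ => true

/-- `m n P`: the maximum mass of an `n × n` binary matrix avoiding `P` as an
interval minor. -/
noncomputable def mP {k l : ℕ} (n : ℕ) (P : Fin k → Fin l → Bool) : ℕ :=
  sSup {m | ∃ A : Fin n → Fin n → Bool, ¬ IntervalMinor P A ∧ mass A = m}

/-- `f_P(t,s)`: the supremum (in `ℕ∞`) of those `N` for which there is an
`N × t` binary matrix with at least `s` ones in each row avoiding `P` as an
interval minor. -/
noncomputable def fP {k l : ℕ} (P : Fin k → Fin l → Bool) (t s : ℕ) : ℕ∞ :=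
  sSup {x : ℕ∞ | ∃ N : ℕ, x = (N : ℕ∞) ∧ ∃ A : Fin N → Fin t → Bool,
    (∀ i, s ≤ (Finset.univ.filter fun j => A i j = true).card) ∧ ¬ IntervalMinor P A}

/-- `g_P(t,s)`: the supremum (in `ℕ∞`) of those `N` for which there is a
`t × N` binary matrix with at least `s` ones in each column avoiding `P` as an
interval minor. -/
noncomputable def gP {k l : ℕ} (P : Fin k → Fin l → Bool) (t s : ℕ) : ℕ∞ :=
  sSup {x : ℕ∞ | ∃ N : ℕ, x = (N : ℕ∞) ∧ ∃ A : Fin t → Fin N → Bool,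
    (∀ j, s ≤ (Finset.univ.filter fun i => A i j = true).card) ∧ ¬ IntervalMinor P A}

/-- `A` contains a `g × g` grid of points, i.e. `J_g` as an interval minor. -/
def HasGrid (A : Set (ℕ × ℕ)) (g : ℕ) : Prop :=
  ∃ p : ℕ → ℕ → ℕ × ℕ, (∀ a b, a < g → b < g → p a b ∈ A) ∧
    (∀ a a' b b', a < a' → a' < g → b < g → b' < g → (p a b).1 < (p a' b').1) ∧
    (∀ a a' b b', b < b' → b' < g → a < g → a' < g → (p a b).2 < (p a' b').2)

def pgraph {n : ℕ} (σ : Equiv.Perm (Fin n)) : Set (ℕ × ℕ) :=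
  {q | ∃ i : Fin n, q = ((i : ℕ), (σ i : ℕ))}

lemma HasGrid.mono {A B : Set (ℕ × ℕ)} {g : ℕ} (h : HasGrid A g) (hAB : A ⊆ B) : HasGrid B g := by
  obtain ⟨p, h1, h2, h3⟩ := h
  exact ⟨p, fun a b ha hb => hAB (h1 a b ha hb), h2, h3⟩

lemma HasGrid.perm {n : ℕ} {σ : Equiv.Perm (Fin n)} {g : ℕ} (h : HasGrid (pgraph σ) g) :
    ∃ x : ℕ → ℕ → ℕ, ∃ y : ℕ → ℕ → ℕ,
    (∀ a b, a < g → b < g → ∃ i : Fin n, (i : ℕ) = x a b ∧ (σ i : ℕ) = y a b) ∧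
    (∀ a a' b b', a < a' → a' < g → b < g → b' < g → x a b < x a' b') ∧
    (∀ a a' b b', b < b' → b' < g → a < g → a' < g → y a b < y a' b') := by
  obtain ⟨p, h1, h2, h3⟩ := h
  refine ⟨fun a b => (p a b).1, fun a b => (p a b).2, ?_, h2, h3⟩
  intro a b ha hb
  obtain ⟨i, hi⟩ := h1 a b ha hb
  exact ⟨i, by simp only [hi], by simp only [hi]⟩

lemma permContains_of_grid {n k : ℕ} (σ : Equiv.Perm (Fin n)) (π : Equiv.Perm (Fin k))
    (h : HasGrid (pgraph σ) k) : PermContains σ π := by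
  obtain ⟨x, y, h1, h2, h3⟩ := h.perm
  choose f hf hg using fun i : Fin k => h1 i (π i) i.2 (π i).2
  refine ⟨f, ?_, ?_⟩
  · intro i j hij
    rw [Fin.lt_def, hf, hf]
    exact h2 _ _ _ _ hij j.2 (π i).2 (π j).2
  · have key : ∀ i j, π i < π j → σ (f i) < σ (f j) := by
      intro i j hij
      rw [Fin.lt_def, hg, hg]
      exact h3 _ _ _ _ hij (π j).2 i.2 j.2
    intro i j
    refine ⟨fun h => ?_, key i j⟩
    by_contra hc
    rcases (not_lt.mp hc).lt_or_eq with h' | h'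
    · exact absurd (key j i h') (not_lt.mpr h.le)
    · have : j = i := π.injective h'
      subst this
      exact lt_irrefl _ h

lemma grid_of_permContains {n k : ℕ} (σ : Equiv.Perm (Fin n)) (π : Equiv.Perm (Fin k)) {g : ℕ}
    (hc : PermContains σ π) (h : HasGrid (pgraph π) g) : HasGrid (pgraph σ) g := by
  obtain ⟨x, y, h1, h2, h3⟩ := h.perm
  obtain ⟨z, hz, hz'⟩ := hc
  have h1' : ∀ a b, ∃ q : ℕ × ℕ, (a < g → b < g → ∃ i : Fin k, (i : ℕ) = x a b ∧ (π i : ℕ) = y a b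
      ∧ q = ((z i : ℕ), (σ (z i) : ℕ))) := by
    intro a b
    by_cases hab : a < g ∧ b < g
    · obtain ⟨i, hi1, hi2⟩ := h1 a b hab.1 hab.2
      exact ⟨((z i : ℕ), (σ (z i) : ℕ)), fun _ _ => ⟨i, hi1, hi2, rfl⟩⟩
    · exact ⟨(0, 0), fun ha hb => absurd ⟨ha, hb⟩ hab⟩
  choose p hp using h1'
  refine ⟨p, ?_, ?_, ?_⟩
  · intro a b ha hb
    obtain ⟨i, -, -, hi⟩ := hp a b ha hb
    exact ⟨z i, hi⟩
  · intro a a' b b' haa ha hb hb'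
    obtain ⟨i, hi1, hi2, hi⟩ := hp a b (haa.trans ha) hb
    obtain ⟨j, hj1, hj2, hj⟩ := hp a' b' ha hb'
    rw [hi, hj]
    have : i < j := by rw [Fin.lt_def, hi1, hj1]; exact h2 _ _ _ _ haa ha hb hb'
    exact hz this
  · intro a a' b b' hbb hb' ha ha'
    obtain ⟨i, hi1, hi2, hi⟩ := hp a b ha (hbb.trans hb')
    obtain ⟨j, hj1, hj2, hj⟩ := hp a' b' ha' hb'
    rw [hi, hj]
    have : π i < π j := by rw [Fin.lt_def, hi2, hj2]; exact h3 _ _ _ _ hbb hb' ha ha'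
    exact (hz' i j).2 this

lemma exists_seq (S : Finset ℕ) {g : ℕ} (h : g ≤ S.card) :
    ∃ f : ℕ → ℕ, (∀ a, a < g → f a ∈ S) ∧ ∀ a a', a < a' → a' < g → f a < f a' := by
  refine ⟨fun a => if h' : a < g then S.orderEmbOfCardLe h ⟨a, h'⟩ else 0, ?_, ?_⟩
  · intro a ha
    simp only [ha, dite_true]
    exact S.orderEmbOfCardLe_mem h _
  · intro a a' h1 h2
    simp only [h2, h1.trans h2, dite_true]
    exact (S.orderEmbOfCardLe h).strictMono h1


def box (n : ℕ) : Finset (ℕ × ℕ) := Finset.range n ×ˢ Finset.range n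

lemma mem_box {n : ℕ} {q : ℕ × ℕ} : q ∈ box n ↔ q.1 < n ∧ q.2 < n := by
  simp [box]

lemma card_box (n : ℕ) : (box n).card = n * n := by simp [box]

def contr (b : ℕ) (q : ℕ × ℕ) : ℕ × ℕ := (q.1 / b, q.2 / b)

lemma lt_of_div_lt {x y b : ℕ} (h : x / b < y / b) : x < y := by
  by_contra hc
  exact absurd (Nat.div_le_div_right (c := b) (not_lt.mp hc)) (not_le.mpr h)

lemma grid_of_contr {A : Finset (ℕ × ℕ)} {b g : ℕ} (h : HasGrid (A.image (contr b)) g) :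
    HasGrid A g := by
  obtain ⟨p, h1, h2, h3⟩ := h
  have : ∀ a c, ∃ q : ℕ × ℕ, a < g → c < g → q ∈ A ∧ contr b q = p a c := by
    intro a c
    by_cases hab : a < g ∧ c < g
    · obtain ⟨q, hq, hq'⟩ := Finset.mem_image.mp (h1 a c hab.1 hab.2)
      exact ⟨q, fun _ _ => ⟨hq, hq'⟩⟩
    · exact ⟨(0, 0), fun ha hb => absurd ⟨ha, hb⟩ hab⟩
  choose q hq using this
  refine ⟨q, fun a c ha hc => (hq a c ha hc).1, ?_, ?_⟩
  · intro a a' c c' haa ha hc hc'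
    have := h2 a a' c c' haa ha hc hc'
    rw [← (hq a c (haa.trans ha) hc).2, ← (hq a' c' ha hc').2] at this
    exact lt_of_div_lt this
  · intro a a' c c' hcc hc ha ha'
    have := h3 a a' c c' hcc hc ha ha'
    rw [← (hq a c ha (hcc.trans hc)).2, ← (hq a' c' ha' hc).2] at this
    exact lt_of_div_lt this

lemma grid_of_swap {A : Finset (ℕ × ℕ)} {g : ℕ} (h : HasGrid (A.image Prod.swap) g) :
    HasGrid A g := by
  obtain ⟨p, h1, h2, h3⟩ := h
  refine ⟨fun a b => (p b a).swap, ?_, ?_, ?_⟩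
  · intro a b ha hb
    obtain ⟨q, hq, hq'⟩ := Finset.mem_image.mp (h1 b a hb ha)
    show (p b a).swap ∈ (A : Set (ℕ × ℕ))
    rw [← hq']; simpa using hq
  · intro a a' b b' haa ha hb hb'
    exact h3 _ _ _ _ haa ha hb hb'
  · intro a a' b b' haa ha hb hb'
    exact h2 _ _ _ _ haa ha hb hb'

/-- columns used in the block `B` -/
def bcols (b : ℕ) (A : Finset (ℕ × ℕ)) (B : ℕ × ℕ) : Finset ℕ :=
  (A.filter (fun q => contr b q = B)).image Prod.snd

def brows (b : ℕ) (A : Finset (ℕ × ℕ)) (B : ℕ × ℕ) : Finset ℕ :=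
  (A.filter (fun q => contr b q = B)).image Prod.fst

lemma divb {b : ℕ} (hb : 0 < b) (x : ℕ) : x / b * b ≤ x ∧ x < x / b * b + b := by
  have h1 := Nat.div_add_mod x b
  have h2 := Nat.mod_lt x hb
  have h3 : x / b * b = b * (x / b) := mul_comm _ _
  omega

lemma bcols_sub {b : ℕ} (hb : 0 < b) (A : Finset (ℕ × ℕ)) (B : ℕ × ℕ) :
    bcols b A B ⊆ Finset.Ico (B.2 * b) (B.2 * b + b) := by
  intro y hy
  simp only [bcols, Finset.mem_image, Finset.mem_filter] at hy
  obtain ⟨q, ⟨hq, rfl⟩, rfl⟩ := hy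
  simp only [contr, Finset.mem_Ico]
  exact divb hb _

lemma wide_count {b : ℕ} (hb : 0 < b) {A : Finset (ℕ × ℕ)} {g n : ℕ} (hA : ¬ HasGrid A g)
    (hn : A.image (contr b) ⊆ box n) :
    ((A.image (contr b)).filter (fun B => g ≤ (bcols b A B).card)).card ≤ n * (2 ^ b * g) := by
  set W := (A.image (contr b)).filter (fun B => g ≤ (bcols b A B).card) with hW
  have hmaps : ∀ B ∈ W, B.2 ∈ Finset.range n := by
    intro B hB
    have := hn (Finset.mem_filter.mp hB).1
    rw [mem_box] at this
    exact Finset.mem_range.mpr this.2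
  have := Finset.card_le_mul_card_image_of_maps_to hmaps (2 ^ b * g) ?_
  · rw [Finset.card_range] at this; linarith
  intro y _
  have hmaps2 : ∀ B ∈ W.filter (fun B => B.2 = y),
      bcols b A B ∈ (Finset.Ico (y * b) (y * b + b)).powerset := by
    intro B hB
    rw [Finset.mem_powerset, ← (Finset.mem_filter.mp hB).2]
    exact bcols_sub hb A B
  have := Finset.card_le_mul_card_image_of_maps_to hmaps2 g ?_
  · rw [Finset.card_powerset, Nat.card_Ico, Nat.add_sub_cancel_left] at this; linarith
  intro C _
  by_contra hc
  push Not at hc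
  apply hA
  set F := (W.filter (fun B => B.2 = y)).filter (fun B => bcols b A B = C) with hF
  have hFmem : ∀ B ∈ F, B.2 = y ∧ bcols b A B = C ∧ g ≤ C.card := by
    intro B hB
    simp only [hF, hW, Finset.mem_filter] at hB
    obtain ⟨⟨⟨h1, h2⟩, h3⟩, h4⟩ := hB
    exact ⟨h3, h4, h4 ▸ h2⟩
  have hCg : g ≤ C.card := by
    obtain ⟨B, hB⟩ := Finset.card_pos.mp (lt_of_le_of_lt (Nat.zero_le _) hc)
    exact (hFmem B hB).2.2
  have hFc : g ≤ (F.image Prod.fst).card := by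
    rw [Finset.card_image_of_injOn]
    · exact hc.le
    · intro B hB B' hB' h
      exact Prod.ext h ((hFmem B hB).1.trans (hFmem B' hB').1.symm)
  obtain ⟨f, hf, hf'⟩ := exists_seq _ hFc
  obtain ⟨e, he, he'⟩ := exists_seq _ hCg
  have : ∀ a c, ∃ q : ℕ × ℕ, a < g → c < g → q ∈ A ∧ q.1 / b = f a ∧ q.2 = e c := by
    intro a c
    by_cases hab : a < g ∧ c < g
    · obtain ⟨B, hB, hB'⟩ := Finset.mem_image.mp (hf a hab.1)
      have h1 := hFmem B hB
      have h2 := he c hab.2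
      rw [← h1.2.1] at h2
      simp only [bcols, Finset.mem_image, Finset.mem_filter] at h2
      obtain ⟨q, ⟨hq1, hq2⟩, hq3⟩ := h2
      refine ⟨q, fun _ _ => ⟨hq1, ?_, hq3⟩⟩
      rw [← hB', ← hq2]; rfl
    · exact ⟨(0, 0), fun ha hb => absurd ⟨ha, hb⟩ hab⟩
  choose q hq using this
  refine ⟨q, fun a c ha hc => (hq a c ha hc).1, ?_, ?_⟩
  · intro a a' c c' haa ha hc hc'
    apply lt_of_div_lt (b := b)
    rw [(hq a c (haa.trans ha) hc).2.1, (hq a' c' ha hc').2.1]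
    exact hf' _ _ haa ha
  · intro a a' c c' hcc hc ha ha'
    rw [(hq a c ha (hcc.trans hc)).2.2, (hq a' c' ha' hc).2.2]
    exact he' _ _ hcc hc

lemma tall_count {b : ℕ} (hb : 0 < b) {A : Finset (ℕ × ℕ)} {g n : ℕ} (hA : ¬ HasGrid A g)
    (hn : A.image (contr b) ⊆ box n) :
    ((A.image (contr b)).filter (fun B => g ≤ (brows b A B).card)).card ≤ n * (2 ^ b * g) := by
  have hA' : ¬ HasGrid ((A.image Prod.swap : Finset (ℕ × ℕ)) : Set (ℕ × ℕ)) g :=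
    fun h => hA (grid_of_swap h)
  have hcomm : (A.image Prod.swap).image (contr b) = (A.image (contr b)).image Prod.swap := by
    rw [Finset.image_image, Finset.image_image]; rfl
  have hn' : (A.image Prod.swap).image (contr b) ⊆ box n := by
    rw [hcomm]
    intro q hq
    obtain ⟨q', hq', rfl⟩ := Finset.mem_image.mp hq
    have := hn hq'
    rw [mem_box] at this ⊢
    exact this.symm
  refine le_trans ?_ (wide_count hb hA' hn')
  rw [← Finset.card_image_of_injective _ Prod.swap_injective]
  apply Finset.card_le_card
  intro q hq
  obtain ⟨B, hB, rfl⟩ := Finset.mem_image.mp hq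
  rw [Finset.mem_filter] at hB ⊢
  refine ⟨by rw [hcomm]; exact Finset.mem_image_of_mem _ hB.1, hB.2.trans ?_⟩
  apply Finset.card_le_card
  intro y hy
  simp only [bcols, brows, Finset.mem_image, Finset.mem_filter] at hy ⊢
  obtain ⟨q, ⟨hq1, hq2⟩, rfl⟩ := hy
  exact ⟨q.swap, ⟨⟨q, hq1, rfl⟩, by rw [← hq2]; rfl⟩, rfl⟩

lemma block_card {b : ℕ} (hb : 0 < b) (A : Finset (ℕ × ℕ)) (B : ℕ × ℕ) :
    (A.filter (fun q => contr b q = B)).card ≤ b ^ 2 := by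
  have : A.filter (fun q => contr b q = B) ⊆
      Finset.Ico (B.1 * b) (B.1 * b + b) ×ˢ Finset.Ico (B.2 * b) (B.2 * b + b) := by
    intro q hq
    obtain ⟨_, rfl⟩ := Finset.mem_filter.mp hq
    simp only [contr, Finset.mem_product, Finset.mem_Ico]
    exact ⟨divb hb _, divb hb _⟩
  refine (Finset.card_le_card this).trans ?_
  simp [sq]

lemma block_card' (b g : ℕ) (A : Finset (ℕ × ℕ)) (B : ℕ × ℕ)
    (h1 : (bcols b A B).card < g) (h2 : (brows b A B).card < g) :
    (A.filter (fun q => contr b q = B)).card ≤ g ^ 2 := by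
  have : A.filter (fun q => contr b q = B) ⊆ brows b A B ×ˢ bcols b A B := by
    intro q hq
    exact Finset.mem_product.mpr ⟨Finset.mem_image_of_mem _ hq, Finset.mem_image_of_mem _ hq⟩
  refine (Finset.card_le_card this).trans ?_
  rw [Finset.card_product, sq]
  exact Nat.mul_le_mul h2.le h1.le

lemma contr_box {b n : ℕ} {A : Finset (ℕ × ℕ)} (hA : A ⊆ box (n * b)) :
    A.image (contr b) ⊆ box n := by
  intro q hq
  obtain ⟨q', hq', rfl⟩ := Finset.mem_image.mp hq
  have := hA hq'
  rw [mem_box] at this ⊢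
  exact ⟨Nat.div_lt_of_lt_mul (by linarith [this.1, mul_comm n b]),
    Nat.div_lt_of_lt_mul (by linarith [this.2, mul_comm n b])⟩

lemma ex_step {b : ℕ} (hb : 0 < b) {A : Finset (ℕ × ℕ)} {g n : ℕ} (hA : ¬ HasGrid A g)
    (hn : A ⊆ box (n * b)) :
    A.card ≤ (A.image (contr b)).card * g ^ 2 + 2 * (n * (2 ^ b * g)) * b ^ 2 := by
  have h0 := contr_box hn
  have hw := wide_count hb hA h0
  have ht := tall_count hb hA h0
  set A' := A.image (contr b) with hA'
  have h1 : A.card = ∑ B ∈ A', (A.filter (fun q => contr b q = B)).card :=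
    Finset.card_eq_sum_card_fiberwise (fun q hq => Finset.mem_image_of_mem _ hq)
  rw [h1]
  have h2 : ∀ B ∈ A', (A.filter (fun q => contr b q = B)).card ≤
      g ^ 2 + ((if g ≤ (bcols b A B).card then b ^ 2 else 0) +
        (if g ≤ (brows b A B).card then b ^ 2 else 0)) := by
    intro B _
    have := block_card hb A B
    split_ifs with h h' h'
    · omega
    · omega
    · omega
    · exact block_card' b g A B (not_le.mp h) (not_le.mp h')
  refine (Finset.sum_le_sum h2).trans ?_
  rw [Finset.sum_add_distrib, Finset.sum_add_distrib, ← Finset.sum_filter, ← Finset.sum_filter]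
  simp only [Finset.sum_const, smul_eq_mul]
  have := Nat.mul_le_mul_right (b ^ 2) hw
  have := Nat.mul_le_mul_right (b ^ 2) ht
  linarith

lemma ex_bound (g : ℕ) (t : ℕ) (A : Finset (ℕ × ℕ)) (hA : ¬ HasGrid A g)
    (hn : A ⊆ box ((g ^ 2 + 2) ^ t)) :
    A.card ≤ (2 * (2 ^ (g ^ 2 + 2) * (g + 1)) * (g ^ 2 + 2) ^ 2) * (g ^ 2 + 2) ^ t := by
  induction t generalizing A with
  | zero =>
    have := Finset.card_le_card hn
    rw [card_box] at this
    simp only [pow_zero, mul_one] at this ⊢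
    refine this.trans ?_
    exact Nat.one_le_iff_ne_zero.mpr (by positivity)
  | succ t ih =>
    set b := g ^ 2 + 2 with hb
    rw [pow_succ] at hn
    have h1 := ex_step (by omega) hA hn
    have h2 := ih (A.image (contr b)) (fun h => hA (grid_of_contr h)) (contr_box hn)
    set K := 2 * (2 ^ b * (g + 1)) * b ^ 2 with hK
    have h3 : 2 * (b ^ t * (2 ^ b * g)) * b ^ 2 ≤ K * b ^ t := by
      rw [hK]
      have : 2 ^ b * g ≤ 2 ^ b * (g + 1) := Nat.mul_le_mul_left _ (by omega)
      calc 2 * (b ^ t * (2 ^ b * g)) * b ^ 2 ≤ 2 * (b ^ t * (2 ^ b * (g + 1))) * b ^ 2 := by gcongr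
        _ = _ := by ring
    calc A.card ≤ (K * b ^ t) * g ^ 2 + K * b ^ t :=
          h1.trans (add_le_add (Nat.mul_le_mul_right _ h2) h3)
      _ = K * b ^ t * (g ^ 2 + 1) := by ring
      _ ≤ K * b ^ t * b := Nat.mul_le_mul_left _ (by omega)
      _ = _ := by ring

open Classical in
noncomputable def gfree (g n : ℕ) : Finset (Finset (ℕ × ℕ)) :=
  (box n).powerset.filter (fun A => ¬ HasGrid (A : Set (ℕ × ℕ)) g)

lemma mem_gfree {g n : ℕ} {A : Finset (ℕ × ℕ)} : A ∈ gfree g n ↔ A ⊆ box n ∧ ¬ HasGrid A g := by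
  simp [gfree]

lemma gfree_bound (g : ℕ) : ∃ M : ℕ, ∀ t, (gfree g ((g ^ 2 + 2) ^ t)).card ≤
    2 ^ (M * (g ^ 2 + 2) ^ t) := by
  set b := g ^ 2 + 2 with hb
  set K := 2 * (2 ^ b * (g + 1)) * b ^ 2 with hK
  have hKpos : 0 < K := by positivity
  refine ⟨K * b ^ 2, fun t => ?_⟩
  induction t with
  | zero =>
    have : (gfree g (b ^ 0)).card ≤ ((box (b ^ 0)).powerset).card :=
      Finset.card_le_card (fun A hA => Finset.mem_powerset.mpr (mem_gfree.mp hA).1)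
    refine this.trans ?_
    rw [Finset.card_powerset, card_box]
    apply Nat.pow_le_pow_right (by norm_num)
    simp only [pow_zero, mul_one]
    exact Nat.one_le_iff_ne_zero.mpr (by positivity)
  | succ t ih =>
    have hmaps : ∀ A ∈ gfree g (b ^ (t + 1)), A.image (contr b) ∈ gfree g (b ^ t) := by
      intro A hA
      rw [mem_gfree, pow_succ] at hA
      rw [mem_gfree]
      exact ⟨contr_box hA.1, fun h => hA.2 (grid_of_contr h)⟩
    have := Finset.card_le_mul_card_image_of_maps_to hmaps (2 ^ (K * b ^ t * b ^ 2)) ?_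
    · refine this.trans ((Nat.mul_le_mul_left _ ih).trans ?_)
      rw [← pow_add]
      apply Nat.pow_le_pow_right (by norm_num)
      calc K * b ^ t * b ^ 2 + K * b ^ 2 * b ^ t = K * b ^ 2 * b ^ t * 2 := by ring
        _ ≤ K * b ^ 2 * b ^ t * b := Nat.mul_le_mul_left _ (by omega)
        _ = _ := by ring
    intro A' hA'
    have hcard := ex_bound g t A' (mem_gfree.mp hA').2 (mem_gfree.mp hA').1
    set Z := (box (b ^ (t + 1))).filter (fun q => contr b q ∈ A') with hZ
    have hZc : Z.card ≤ K * b ^ t * b ^ 2 := by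
      have h := Finset.card_le_mul_card_image_of_maps_to (s := Z) (t := A') (f := contr b)
        (fun q hq => (Finset.mem_filter.mp hq).2) (b ^ 2)
        (fun B _ => block_card (by omega) Z B)
      refine h.trans ?_
      rw [mul_comm]
      exact Nat.mul_le_mul_right _ hcard
    calc _ ≤ Z.powerset.card := by
          apply Finset.card_le_card
          intro A hA
          obtain ⟨h1, h2⟩ := Finset.mem_filter.mp hA
          rw [Finset.mem_powerset]
          intro q hq
          rw [hZ, Finset.mem_filter]
          exact ⟨(mem_gfree.mp h1).1 hq, h2 ▸ Finset.mem_image_of_mem _ hq⟩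
      _ ≤ _ := by
          rw [Finset.card_powerset]
          exact Nat.pow_le_pow_right (by norm_num) hZc

def pfin {n : ℕ} (σ : Equiv.Perm (Fin n)) : Finset (ℕ × ℕ) :=
  Finset.univ.image (fun i : Fin n => ((i : ℕ), (σ i : ℕ)))

lemma coe_pfin {n : ℕ} (σ : Equiv.Perm (Fin n)) : (pfin σ : Set (ℕ × ℕ)) = pgraph σ := by
  ext q
  simp [pfin, pgraph, eq_comm]

lemma pfin_inj {n : ℕ} : Function.Injective (pfin (n := n)) := by
  intro σ τ h
  ext i
  have : ((i : ℕ), (σ i : ℕ)) ∈ pfin τ := by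
    rw [← h]; exact Finset.mem_image_of_mem _ (Finset.mem_univ i)
  simp only [pfin, Finset.mem_image, Finset.mem_univ, true_and, Prod.mk.injEq] at this
  obtain ⟨j, hj, hj'⟩ := this
  have : j = i := Fin.ext hj
  subst this
  exact hj'.symm

lemma SU_upper {k : ℕ} (U : Finset (Equiv.Perm (Fin k))) (hU : U.Nonempty) :
    ∃ M : ℕ, ∃ b : ℕ, 2 ≤ b ∧ ∀ t, SU (b ^ t) U ≤ 2 ^ (M * b ^ t) := by
  obtain ⟨M, hM⟩ := gfree_bound k
  refine ⟨M, k ^ 2 + 2, by omega, fun t => le_trans ?_ (hM t)⟩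
  obtain ⟨π, hπ⟩ := hU
  unfold SU
  rw [← Nat.card_eq_finsetCard]
  have hmem : ∀ σ : {σ : Equiv.Perm (Fin ((k ^ 2 + 2) ^ t)) // ∀ π ∈ U, ¬ PermContains σ π},
      pfin σ.1 ∈ gfree k ((k ^ 2 + 2) ^ t) := by
    intro σ
    rw [mem_gfree, coe_pfin]
    refine ⟨?_, fun h => σ.2 π hπ (permContains_of_grid _ _ h)⟩
    intro q hq
    simp only [pfin, Finset.mem_image, Finset.mem_univ, true_and] at hq
    obtain ⟨i, rfl⟩ := hq
    rw [mem_box]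
    exact ⟨i.2, (σ.1 i).2⟩
  apply Nat.card_le_card_of_injective (fun σ => (⟨pfin σ.1, hmem σ⟩ : gfree k _))
  intro σ τ h
  exact Subtype.ext (pfin_inj (congrArg Subtype.val h))


open Classical in
noncomputable def goodP (n g : ℕ) : Finset (Equiv.Perm (Fin n)) :=
  Finset.univ.filter (fun σ => ¬ HasGrid (pgraph σ) g)

lemma mem_goodP {n g : ℕ} {σ : Equiv.Perm (Fin n)} : σ ∈ goodP n g ↔ ¬ HasGrid (pgraph σ) g := by
  simp [goodP]

lemma enum_key {α : Type*} [DecidableEq α] (S : Finset α) (key : α → ℕ) (hk : Set.InjOn key S) {N : ℕ}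
    (hN : S.card = N) : ∃ e : Fin N → α, (∀ i, e i ∈ S) ∧ StrictMono (key ∘ e) ∧
      ∀ s ∈ S, ∃ i, e i = s := by
  have hc : (S.image key).card = N := by rw [Finset.card_image_of_injOn hk, hN]
  set o := (S.image key).orderEmbOfFin hc with ho
  have h1 : ∀ i, ∃ s ∈ S, key s = o i := fun i =>
    Finset.mem_image.mp ((S.image key).orderEmbOfFin_mem hc i)
  choose e he he' using h1
  refine ⟨e, he, ?_, ?_⟩
  · intro i j hij
    simp only [Function.comp, he']
    exact o.strictMono hij
  · intro s hs
    have : key s ∈ Set.range o := by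
      rw [ho, Finset.range_orderEmbOfFin]
      exact Finset.mem_coe.mpr (Finset.mem_image_of_mem _ hs)
    obtain ⟨i, hi⟩ := this
    exact ⟨i, hk (he i) hs (by rw [he', hi])⟩

lemma key_lt {m a b a' b' : ℕ} (hb : b < m) (hb' : b' < m) :
    a * m + b < a' * m + b' ↔ a < a' ∨ (a = a' ∧ b < b') := by
  constructor
  · intro h
    rcases lt_trichotomy a a' with h1 | h1 | h1
    · exact Or.inl h1
    · subst h1; right; exact ⟨rfl, by omega⟩
    · have := Nat.mul_le_mul_right m (Nat.succ_le_of_lt h1)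
      rw [Nat.succ_mul] at this; omega
  · rintro (h | ⟨rfl, h⟩)
    · have := Nat.mul_le_mul_right m (Nat.succ_le_of_lt h)
      rw [Nat.succ_mul] at this; omega
    · omega

lemma perm_of_set {m N : ℕ} (S : Finset (ℕ × ℕ)) (hS : S ⊆ box m) (hN : S.card = N) :
    ∃ (σ : Equiv.Perm (Fin N)) (r c : Fin N → Fin m), Monotone r ∧ Monotone c ∧
      S = Finset.univ.image (fun i => ((r i : ℕ), (c (σ i) : ℕ))) ∧
      (∀ i j, r i = r j → i < j → σ i < σ j) ∧
      (∀ i j, c (σ i) = c (σ j) → i < j → σ i < σ j) := by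
  have hb : ∀ q ∈ S, q.1 < m ∧ q.2 < m := fun q hq => mem_box.mp (hS hq)
  have inj1 : Set.InjOn (fun q : ℕ × ℕ => q.1 * m + q.2) S := by
    intro q hq q' hq' h
    have h1 := (key_lt (a := q.1) (a' := q'.1) (hb q hq).2 (hb q' hq').2).not
    have h2 := (key_lt (a := q'.1) (a' := q.1) (hb q' hq').2 (hb q hq).2).not
    simp only at h
    have h1 := h1.mp (by omega)
    have h2 := h2.mp (by omega)
    apply Prod.ext <;> omega
  have inj2 : Set.InjOn (fun q : ℕ × ℕ => q.2 * m + q.1) S := by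
    intro q hq q' hq' h
    have h1 := (key_lt (a := q.2) (a' := q'.2) (hb q hq).1 (hb q' hq').1).not
    have h2 := (key_lt (a := q'.2) (a' := q.2) (hb q' hq').1 (hb q hq).1).not
    simp only at h
    have h1 := h1.mp (by omega)
    have h2 := h2.mp (by omega)
    apply Prod.ext <;> omega
  obtain ⟨e, he, hem, hes⟩ := enum_key S _ inj1 hN
  obtain ⟨f, hf, hfm, hfs⟩ := enum_key S _ inj2 hN
  choose s hs using fun i => hfs (e i) (he i)
  have ei : Function.Injective e := fun i j h => hem.injective (by simp [h])
  have si : Function.Injective s := fun i j h => ei (by rw [← hs, ← hs, h])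
  have e1 : ∀ i j, i < j → (e i).1 < (e j).1 ∨ ((e i).1 = (e j).1 ∧ (e i).2 < (e j).2) :=
    fun i j hij => (key_lt (hb _ (he i)).2 (hb _ (he j)).2).mp (hem hij)
  have f1 : ∀ i j, i < j → (f i).2 < (f j).2 ∨ ((f i).2 = (f j).2 ∧ (f i).1 < (f j).1) :=
    fun i j hij => (key_lt (hb _ (hf i)).1 (hb _ (hf j)).1).mp (hfm hij)
  have f2 : ∀ i j, (f i).2 < (f j).2 ∨ ((f i).2 = (f j).2 ∧ (f i).1 < (f j).1) → i < j :=
    fun i j hij => hfm.lt_iff_lt.mp ((key_lt (hb _ (hf i)).1 (hb _ (hf j)).1).mpr hij)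
  refine ⟨Equiv.ofBijective s (Finite.injective_iff_bijective.mp si),
    fun i => ⟨(e i).1, (hb _ (he i)).1⟩, fun i => ⟨(f i).2, (hb _ (hf i)).2⟩, ?_, ?_, ?_, ?_, ?_⟩
  · intro i j hij
    rcases hij.lt_or_eq with h | rfl
    · have := e1 i j h
      simp only [Fin.mk_le_mk]; omega
    · exact le_rfl
  · intro i j hij
    rcases hij.lt_or_eq with h | rfl
    · have := f1 i j h
      simp only [Fin.mk_le_mk]; omega
    · exact le_rfl
  · ext q
    simp only [Equiv.ofBijective_apply, hs, Finset.mem_image, Finset.mem_univ, true_and]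
    constructor
    · intro hq
      obtain ⟨i, hi⟩ := hes q hq
      exact ⟨i, by rw [← hi]⟩
    · rintro ⟨i, rfl⟩
      exact he i
  · intro i j h hij
    simp only [Fin.mk.injEq] at h
    simp only [Equiv.ofBijective_apply]
    apply f2
    rw [hs, hs]
    have := e1 i j hij
    omega
  · intro i j h hij
    simp only [Fin.mk.injEq, Equiv.ofBijective_apply, hs] at h
    simp only [Equiv.ofBijective_apply]
    apply f2
    rw [hs, hs]
    have := e1 i j hij
    omega

lemma grid_of_blowup {m N l : ℕ} {A : Finset (ℕ × ℕ)} (σ : Equiv.Perm (Fin N)) (r c : Fin N → Fin m)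
    (hr : Monotone r) (hc : Monotone c) (hA : ∀ i, ((r i : ℕ), (c (σ i) : ℕ)) ∈ A)
    (hri : ∀ i j, r i = r j → i < j → σ i < σ j)
    (hci : ∀ i j, c (σ i) = c (σ j) → i < j → σ i < σ j)
    (h : HasGrid (pgraph σ) (3 * l)) : HasGrid A l := by
  obtain ⟨x, y, h1, h2, h3⟩ := h.perm
  rcases Nat.eq_zero_or_pos l with rfl | hl
  · exact ⟨fun _ _ => (0, 0), by simp, by simp, by simp⟩
  have hN : Nonempty (Fin N) := ⟨(h1 0 0 (by omega) (by omega)).choose⟩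
  have h1' : ∀ a b, ∃ i : Fin N, a < 3 * l → b < 3 * l → (i : ℕ) = x a b ∧ (σ i : ℕ) = y a b := by
    intro a b
    by_cases hab : a < 3 * l ∧ b < 3 * l
    · obtain ⟨i, hi⟩ := h1 a b hab.1 hab.2
      exact ⟨i, fun _ _ => hi⟩
    · exact ⟨hN.some, fun ha hb => absurd ⟨ha, hb⟩ hab⟩
  choose z hz using h1'
  have hx : ∀ a a' b b', a < a' → a' < 3 * l → b < 3 * l → b' < 3 * l → z a b < z a' b' := by
    intro a a' b b' haa ha hb hb'
    rw [Fin.lt_def, (hz a b (by omega) hb).1, (hz a' b' ha hb').1]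
    exact h2 _ _ _ _ haa ha hb hb'
  have hy : ∀ a a' b b', b < b' → b' < 3 * l → a < 3 * l → a' < 3 * l →
      σ (z a b) < σ (z a' b') := by
    intro a a' b b' hbb hb ha ha'
    rw [Fin.lt_def, (hz a b ha (by omega)).2, (hz a' b' ha' hb).2]
    exact h3 _ _ _ _ hbb hb ha ha'
  refine ⟨fun a b => ((r (z (3 * a) (3 * b)) : ℕ), (c (σ (z (3 * a) (3 * b))) : ℕ)),
    fun a b _ _ => hA _, ?_, ?_⟩
  · intro a a' b b' haa ha hb hb'
    have hle := hr (hx (3 * a) (3 * a') (3 * b) (3 * b') (by omega) (by omega) (by omega) (by omega)).le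
    rcases hle.lt_or_eq with h | h
    · exact h
    exfalso
    have l1 := hr (hx (3 * a) (3 * a + 1) (3 * b) 1 (by omega) (by omega) (by omega) (by omega)).le
    have l2 := hx (3 * a + 1) (3 * a + 2) 1 0 (by omega) (by omega) (by omega) (by omega)
    have l3 := hr (hx (3 * a + 2) (3 * a') 0 (3 * b') (by omega) (by omega) (by omega) (by omega)).le
    have l4 := hr l2.le
    have e : r (z (3 * a + 1) 1) = r (z (3 * a + 2) 0) := by
      apply le_antisymm l4
      exact l3.trans (h.ge.trans l1)
    have := hri _ _ e l2
    have := hy (3 * a + 2) (3 * a + 1) 0 1 (by omega) (by omega) (by omega) (by omega)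
    exact absurd this (by order)
  · intro a a' b b' hbb hb ha ha'
    have hle := hc (hy (3 * a) (3 * a') (3 * b) (3 * b') (by omega) (by omega) (by omega) (by omega)).le
    rcases hle.lt_or_eq with h | h
    · exact h
    exfalso
    have l1 := hc (hy (3 * a) 1 (3 * b) (3 * b + 1) (by omega) (by omega) (by omega) (by omega)).le
    have l2 := hy 1 0 (3 * b + 1) (3 * b + 2) (by omega) (by omega) (by omega) (by omega)
    have l3 := hc (hy 0 (3 * a') (3 * b + 2) (3 * b') (by omega) (by omega) (by omega) (by omega)).le
    have l4 := hc l2.le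
    have e : c (σ (z 1 (3 * b + 1))) = c (σ (z 0 (3 * b + 2))) := by
      apply le_antisymm l4
      exact l3.trans (h.ge.trans l1)
    have := hci _ _ e.symm (hx 0 1 _ _ (by omega) (by omega) (by omega) (by omega))
    exact absurd this (by order)

lemma card_mono (N m : ℕ) : Nat.card {r : Fin N → Fin m // Monotone r} ≤ 2 ^ (N + m) := by
  have : Nat.card (Finset (Fin (N + m))) = 2 ^ (N + m) := by simp
  rw [← this]
  have key : ∀ r : {r : Fin N → Fin m // Monotone r},
      StrictMono (fun i : Fin N => (⟨i + r.1 i, by omega⟩ : Fin (N + m))) := by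
    intro r i j hij
    have := r.2 hij.le
    rw [Fin.lt_def] at hij ⊢
    rw [Fin.le_def] at this
    simp only
    omega
  apply Nat.card_le_card_of_injective (fun r : {r : Fin N → Fin m // Monotone r} =>
    Finset.univ.image (fun i : Fin N => (⟨i + r.1 i, by omega⟩ : Fin (N + m))))
  intro r s h
  have h' : Set.range (fun i : Fin N => (⟨i + r.1 i, by omega⟩ : Fin (N + m))) =
      Set.range (fun i : Fin N => (⟨i + s.1 i, by omega⟩ : Fin (N + m))) := by
    have := congrArg (fun t : Finset (Fin (N + m)) => (t : Set (Fin (N + m)))) h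
    simpa using this
  have := ((key r).range_inj (key s)).mp h'
  apply Subtype.ext
  funext i
  have := congrFun this i
  simp only [Fin.mk.injEq] at this
  apply Fin.ext; omega

lemma choose_le_goodP {m N l : ℕ} (A : Finset (ℕ × ℕ)) (hA : A ⊆ box m) (hg : ¬ HasGrid A l) :
    A.card.choose N ≤ (goodP N (3 * l)).card * (2 ^ (N + m) * 2 ^ (N + m)) := by
  rw [← Finset.card_powersetCard]
  have hS : ∀ S : Finset.powersetCard N A, ∃ (σ : Equiv.Perm (Fin N)) (r c : Fin N → Fin m),
      Monotone r ∧ Monotone c ∧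
      S.1 = Finset.univ.image (fun i => ((r i : ℕ), (c (σ i) : ℕ))) ∧ σ ∈ goodP N (3 * l) := by
    intro S
    obtain ⟨hS1, hS2⟩ := Finset.mem_powersetCard.mp S.2
    obtain ⟨σ, r, c, h1, h2, h3, h4, h5⟩ := perm_of_set S.1 (hS1.trans hA) hS2
    refine ⟨σ, r, c, h1, h2, h3, mem_goodP.mpr fun h => hg ?_⟩
    refine grid_of_blowup σ r c h1 h2 (fun i => hS1 ?_) h4 h5 h
    rw [h3]
    exact Finset.mem_image_of_mem _ (Finset.mem_univ i)
  choose σ r c h1 h2 h3 h4 using hS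
  have := Nat.card_le_card_of_injective (fun S : Finset.powersetCard N A =>
    ((⟨σ S, h4 S⟩, ⟨r S, h1 S⟩, ⟨c S, h2 S⟩) : goodP N (3 * l) ×
      {r : Fin N → Fin m // Monotone r} × {r : Fin N → Fin m // Monotone r})) ?_
  · rw [Nat.card_prod, Nat.card_prod, Nat.card_eq_finsetCard, Nat.card_eq_finsetCard] at this
    refine this.trans ?_
    have := card_mono N m
    gcongr
  · intro S T h
    simp only [Prod.mk.injEq, Subtype.mk.injEq] at h
    apply Subtype.ext
    rw [h3, h3, h.1, h.2.1, h.2.2]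


def dsum {m q : ℕ} (hm : 0 < m) (τ : Fin q → Equiv.Perm (Fin m)) (i : ℕ) : ℕ :=
  if h : i / m < q then i / m * m + τ ⟨i / m, h⟩ ⟨i % m, Nat.mod_lt _ hm⟩ else i

lemma dsum_div {m q : ℕ} (hm : 0 < m) (τ : Fin q → Equiv.Perm (Fin m)) (i : ℕ) :
    dsum hm τ i / m = i / m := by
  unfold dsum
  split_ifs with h
  · rw [mul_comm, Nat.mul_add_div hm, Nat.div_eq_of_lt (Fin.is_lt _), add_zero]
  · rfl

lemma dsum_mod {m q : ℕ} (hm : 0 < m) (τ : Fin q → Equiv.Perm (Fin m)) (i : ℕ) (h : i / m < q) :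
    dsum hm τ i % m = τ ⟨i / m, h⟩ ⟨i % m, Nat.mod_lt _ hm⟩ := by
  unfold dsum
  rw [dif_pos h, mul_comm, Nat.mul_add_mod, Nat.mod_eq_of_lt (Fin.is_lt _)]

lemma dsum_inj {m q : ℕ} (hm : 0 < m) (τ : Fin q → Equiv.Perm (Fin m)) :
    Function.Injective (dsum hm τ) := by
  intro i j hij
  have h1 : i / m = j / m := by rw [← dsum_div hm τ i, hij, dsum_div]
  by_cases h : i / m < q
  · have h' : j / m < q := h1 ▸ h
    have h2 := dsum_mod hm τ i h
    rw [hij, dsum_mod hm τ j h'] at h2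
    have h3 : (⟨j / m, h'⟩ : Fin q) = ⟨i / m, h⟩ := Fin.ext h1.symm
    rw [h3] at h2
    have h4 := (τ ⟨i / m, h⟩).injective (Fin.ext h2)
    have h5 : j % m = i % m := congrArg Fin.val h4
    rw [← Nat.div_add_mod i m, ← Nat.div_add_mod j m, h1, h5]
  · have h' : ¬ j / m < q := h1 ▸ h
    unfold dsum at hij
    rwa [dif_neg h, dif_neg h'] at hij

lemma dsum_lt {m q n : ℕ} (hm : 0 < m) (hn : q * m ≤ n) (τ : Fin q → Equiv.Perm (Fin m)) (i : ℕ)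
    (hi : i < n) : dsum hm τ i < n := by
  by_cases h : i / m < q
  · have h1 := dsum_div hm τ i
    have : dsum hm τ i < q * m := by
      rw [← Nat.div_lt_iff_lt_mul hm, h1]; exact h
    omega
  · unfold dsum
    rwa [dif_neg h]

noncomputable def dperm {m q n : ℕ} (hm : 0 < m) (hn : q * m ≤ n) (τ : Fin q → Equiv.Perm (Fin m)) :
    Equiv.Perm (Fin n) :=
  Equiv.ofBijective (fun i : Fin n => (⟨dsum hm τ i, dsum_lt hm hn τ i i.2⟩ : Fin n))
    (Finite.injective_iff_bijective.mp (fun i j h => by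
      simp only [Fin.mk.injEq] at h
      exact Fin.ext (dsum_inj hm τ h)))

lemma dperm_val {m q n : ℕ} (hm : 0 < m) (hn : q * m ≤ n) (τ : Fin q → Equiv.Perm (Fin m))
    (i : Fin n) : (dperm hm hn τ i : ℕ) = dsum hm τ i := rfl

lemma dperm_inj {m q n : ℕ} (hm : 0 < m) (hn : q * m ≤ n) :
    Function.Injective (dperm hm hn : (Fin q → Equiv.Perm (Fin m)) → Equiv.Perm (Fin n)) := by
  intro τ τ' h
  funext y
  ext i
  have hlt : i + m * y < n := by
    have h1 := Nat.mul_le_mul_right m (Nat.succ_le_of_lt y.2)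
    rw [Nat.succ_mul] at h1
    have := mul_comm m (y : ℕ)
    omega
  have hy : ((i : ℕ) + m * y) / m = y := by
    rw [Nat.add_mul_div_left _ _ hm, Nat.div_eq_of_lt i.2, zero_add]
  have hi : ((i : ℕ) + m * y) % m = i := by
    rw [Nat.add_mul_mod_self_left, Nat.mod_eq_of_lt i.2]
  have h1 := dsum_mod hm τ _ (hy ▸ y.2)
  have h2 := dsum_mod hm τ' _ (hy ▸ y.2)
  have h3 : dsum hm τ (i + m * y) = dsum hm τ' (i + m * y) := by
    have := congrArg (fun s : Equiv.Perm (Fin n) => ((s ⟨i + m * y, hlt⟩ : Fin n) : ℕ)) h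
    exact this
  rw [h3, h2] at h1
  simp only [hy, hi] at h1
  exact h1.symm

lemma dperm_good {m q n L : ℕ} (hL : 2 ≤ L) (hm : 0 < m) (hn : q * m ≤ n)
    (τ : Fin q → Equiv.Perm (Fin m))
    (hτ : ∀ y, ¬ HasGrid (pgraph (τ y)) L) : ¬ HasGrid (pgraph (dperm hm hn τ)) (L + 2) := by
  intro h
  obtain ⟨x, y, h1, h2, h3⟩ := h.perm
  have hxy : ∀ a b, a < L + 2 → b < L + 2 → y a b = dsum hm τ (x a b) := by
    intro a b ha hb
    obtain ⟨i, hi, hi'⟩ := h1 a b ha hb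
    rw [← hi, ← hi', dperm_val]
  have hdiv : ∀ a b, a < L + 2 → b < L + 2 → y a b / m = x a b / m := by
    intro a b ha hb
    rw [hxy a b ha hb, dsum_div]
  set z := x 0 (L + 1) / m with hz
  have e1 : x (L + 1) 0 / m = z := by
    apply le_antisymm
    · have := Nat.div_le_div_right (c := m) (h3 (L + 1) 0 0 (L + 1) (by omega) (by omega) (by omega) (by omega)).le
      rwa [hdiv _ _ (by omega) (by omega), hdiv _ _ (by omega) (by omega)] at this
    · exact Nat.div_le_div_right (h2 0 (L + 1) (L + 1) 0 (by omega) (by omega) (by omega) (by omega)).le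
  have e2 : ∀ a b, a < L → b < L → x (a + 1) (b + 1) / m = z := by
    intro a b ha hb
    apply le_antisymm
    · rw [← e1]
      exact Nat.div_le_div_right (h2 _ _ _ _ (by omega) (by omega) (by omega) (by omega)).le
    · exact Nat.div_le_div_right (h2 _ _ _ _ (by omega) (by omega) (by omega) (by omega)).le
  by_cases hq : z < q
  · apply hτ ⟨z, hq⟩
    refine ⟨fun a b => (x (a + 1) (b + 1) % m, y (a + 1) (b + 1) % m), ?_, ?_, ?_⟩
    · intro a b ha hb
      refine ⟨⟨x (a + 1) (b + 1) % m, Nat.mod_lt _ hm⟩, ?_⟩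
      simp only [Prod.mk.injEq, true_and]
      have := e2 a b ha hb
      rw [hxy _ _ (by omega) (by omega), dsum_mod hm τ _ (this ▸ hq)]
      simp only [this]
    · intro a a' b b' haa ha hb hb'
      have l1 := h2 (a + 1) (a' + 1) (b + 1) (b' + 1) (by omega) (by omega) (by omega) (by omega)
      have l2 := Nat.div_add_mod (x (a + 1) (b + 1)) m
      have l3 := Nat.div_add_mod (x (a' + 1) (b' + 1)) m
      rw [e2 _ _ (by omega) (by omega)] at l2 l3
      simp only
      omega
    · intro a a' b b' haa ha hb hb'
      have l1 := h3 (a + 1) (a' + 1) (b + 1) (b' + 1) (by omega) (by omega) (by omega) (by omega)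
      have l2 := Nat.div_add_mod (y (a + 1) (b + 1)) m
      have l3 := Nat.div_add_mod (y (a' + 1) (b' + 1)) m
      rw [hdiv _ _ (by omega) (by omega), e2 _ _ (by omega) (by omega)] at l2 l3
      simp only
      omega
  · have l1 := h2 1 2 2 1 (by omega) (by omega) (by omega) (by omega)
    have l2 := h3 2 1 1 2 (by omega) (by omega) (by omega) (by omega)
    rw [hxy _ _ (by omega) (by omega), hxy _ _ (by omega) (by omega)] at l2
    have f1 := e2 0 1 (by omega) (by omega)
    have f2 := e2 1 0 (by omega) (by omega)
    norm_num at f1 f2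
    unfold dsum at l2
    rw [dif_neg (by rw [f2]; exact hq), dif_neg (by rw [f1]; exact hq)] at l2
    omega

lemma goodP_pow {m q n L : ℕ} (hL : 2 ≤ L) (hm : 0 < m) (hn : q * m ≤ n) :
    (goodP m L).card ^ q ≤ (goodP n (L + 2)).card := by
  have := Nat.card_le_card_of_injective (fun τ : Fin q → goodP m L =>
    (⟨dperm hm hn (fun y => (τ y).1),
      mem_goodP.mpr (dperm_good hL hm hn _ fun y => mem_goodP.mp (τ y).2)⟩ : goodP n (L + 2))) ?_
  · simpa using this
  · intro τ τ' h
    have := dperm_inj hm hn (congrArg Subtype.val h)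
    funext y
    exact Subtype.ext (congrFun this y)

lemma goodP_le_SU {k n g : ℕ} (U : Finset (Equiv.Perm (Fin k)))
    (hU : ∀ π ∈ U, HasGrid (pgraph π) g) : (goodP n g).card ≤ SU n U := by
  unfold SU
  rw [← Nat.card_eq_finsetCard]
  apply Nat.card_le_card_of_injective (fun σ : goodP n g =>
    (⟨σ.1, fun π hπ hc => mem_goodP.mp σ.2 (grid_of_permContains _ _ hc (hU π hπ))⟩ :
      {σ : Equiv.Perm (Fin n) // ∀ π ∈ U, ¬ PermContains σ π}))
  intro σ τ h
  exact Subtype.ext (congrArg (fun s : {σ : Equiv.Perm (Fin n) // ∀ π ∈ U, ¬ PermContains σ π} => s.1) h)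


open Classical in
lemma avoid_count {k : ℕ} (J I : Finset (Fin k)) :
    (Finset.univ.filter (fun π : Equiv.Perm (Fin k) => ∀ i ∈ I, π i ∉ J)).card * k ^ I.card ≤
      (k - J.card) ^ I.card * k.factorial := by
  induction I using Finset.induction_on with
  | empty => simp [Fintype.card_perm]
  | insert i0 I hi0 ih =>
    rw [Finset.card_insert_of_notMem hi0]
    set F := Finset.univ.filter (fun π : Equiv.Perm (Fin k) => ∀ i ∈ I, π i ∉ J) with hF
    set F' := Finset.univ.filter (fun π : Equiv.Perm (Fin k) => ∀ i ∈ insert i0 I, π i ∉ J) with hF'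
    have hg : ∀ j ∈ J, F.card ≤ k * (F.filter (fun π => π i0 = j)).card := by
      intro j hj
      have hmaps : ∀ π ∈ F, π.symm j ∈ (Finset.univ : Finset (Fin k)) := fun _ _ => Finset.mem_univ _
      have := Finset.card_le_mul_card_image_of_maps_to hmaps
        (F.filter (fun π => π i0 = j)).card ?_
      · rw [Finset.card_univ, Fintype.card_fin] at this; linarith
      intro i' _
      apply Finset.card_le_card_of_injOn (fun π => Equiv.swap i0 i' * π.symm |>.symm)
      · intro π hπ
        simp only [hF, Finset.coe_filter, Finset.mem_filter, Finset.mem_univ, true_and,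
          Set.mem_setOf_eq] at hπ ⊢
        have hpi : π i' = j := by rw [← hπ.2]; simp
        have hi' : i' ∉ I := fun h => hπ.1 i' h (hpi ▸ hj)
        constructor
        · intro i hi
          have h1 : i ≠ i0 := fun h => hi0 (h ▸ hi)
          have h2 : i ≠ i' := fun h => hi' (h ▸ hi)
          have : (Equiv.swap i0 i' * π.symm).symm i = π i := by
            simp [Equiv.symm_apply_eq, Equiv.swap_apply_of_ne_of_ne h1 h2]
          rw [this]
          exact hπ.1 i hi
        · simp [Equiv.symm_apply_eq, ← hπ.2]
      · intro π _ π' _ h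
        have h' := Equiv.symm_bijective.injective h
        have h'' := mul_left_cancel h'
        exact Equiv.symm_bijective.injective h''
    have hsum : J.card * F.card ≤ k * (F.filter (fun π => π i0 ∈ J)).card := by
      have e : (F.filter (fun π => π i0 ∈ J)).card = ∑ j ∈ J, (F.filter (fun π => π i0 = j)).card := by
        rw [Finset.card_eq_sum_card_fiberwise (f := fun π => π i0) (t := J)]
        · apply Finset.sum_congr rfl
          intro j hj
          congr 1
          ext π
          simp only [Finset.mem_filter]
          constructor
          · rintro ⟨⟨h1, _⟩, h2⟩; exact ⟨h1, h2⟩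
          · rintro ⟨h1, h2⟩; exact ⟨⟨h1, h2 ▸ hj⟩, h2⟩
        · intro π hπ
          exact (Finset.mem_filter.mp hπ).2
      rw [e, Finset.mul_sum, ← smul_eq_mul, ← Finset.sum_const]
      exact Finset.sum_le_sum hg
    have hsplit : (F.filter (fun π => π i0 ∈ J)).card + F'.card = F.card := by
      have : F' = F.filter (fun π => ¬ π i0 ∈ J) := by
        ext π
        simp [hF, hF', Finset.mem_filter, and_comm]
      rw [this]
      exact Finset.card_filter_add_card_filter_not _
    have hJ : J.card ≤ k := by simpa using J.card_le_univ
    obtain ⟨d, hd⟩ := Nat.exists_eq_add_of_le hJ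
    have hkd : k - J.card = d := by omega
    rw [hkd] at ih ⊢
    have step : F'.card * k ≤ d * F.card := by
      have e1 : k * F.card = J.card * F.card + d * F.card := by
        rw [← add_mul, ← hd]
      have e2 : k * F.card = k * (F.filter (fun π => π i0 ∈ J)).card + k * F'.card := by
        rw [← mul_add, hsplit]
      have e3 : F'.card * k = k * F'.card := mul_comm _ _
      omega
    calc F'.card * k ^ (I.card + 1) = (F'.card * k) * k ^ I.card := by ring
      _ ≤ (d * F.card) * k ^ I.card := Nat.mul_le_mul_right _ step
      _ = d * (F.card * k ^ I.card) := by ring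
      _ ≤ d * (d ^ I.card * k.factorial) := Nat.mul_le_mul_left _ ih
      _ = _ := by ring

/-- consecutive block of positions -/
def blk (k w a : ℕ) : Finset (Fin k) := Finset.univ.filter (fun i => a * w ≤ i ∧ i < a * w + w)

lemma card_blk {k w a g : ℕ} (h : g * w ≤ k) (ha : a < g) : (blk k w a).card = w := by
  have h1 : a * w + w ≤ k := by
    have := Nat.mul_le_mul_right w (Nat.succ_le_of_lt ha)
    rw [Nat.succ_mul] at this; omega
  have : (blk k w a).image Fin.val = Finset.Ico (a * w) (a * w + w) := by
    ext x
    simp only [blk, Finset.mem_image, Finset.mem_filter, Finset.mem_univ, true_and, Finset.mem_Ico]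
    constructor
    · rintro ⟨i, hi, rfl⟩; exact hi
    · intro hx; exact ⟨⟨x, by omega⟩, hx, rfl⟩
  rw [← Finset.card_image_of_injective _ Fin.val_injective, this]
  simp

lemma blk_lt {k w a a' : ℕ} (h : a < a') {i j : Fin k} (hi : i ∈ blk k w a) (hj : j ∈ blk k w a') :
    (i : ℕ) < j := by
  simp only [blk, Finset.mem_filter, Finset.mem_univ, true_and] at hi hj
  have := Nat.mul_le_mul_right w (Nat.succ_le_of_lt h)
  rw [Nat.succ_mul] at this; omega

lemma goodP_card {k w g : ℕ} (h : g * w ≤ k) :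
    (goodP k g).card * k ^ w ≤ g ^ 2 * ((k - w) ^ w * k.factorial) := by
  classical
  set T := Finset.range g ×ˢ Finset.range g with hT
  have hsub : goodP k g ⊆ T.biUnion (fun t =>
      Finset.univ.filter (fun π : Equiv.Perm (Fin k) => ∀ i ∈ blk k w t.1, π i ∉ blk k w t.2)) := by
    intro π hπ
    by_contra hc
    apply mem_goodP.mp hπ
    simp only [hT, Finset.mem_biUnion, Finset.mem_product, Finset.mem_range, Finset.mem_filter,
      Finset.mem_univ, true_and, Prod.exists, not_exists, not_and, not_forall, not_not] at hc
    have : ∀ a b, ∃ q : ℕ × ℕ, a < g → b < g → ∃ i : Fin k, i ∈ blk k w a ∧ π i ∈ blk k w b ∧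
        q = ((i : ℕ), (π i : ℕ)) := by
      intro a b
      by_cases hab : a < g ∧ b < g
      · obtain ⟨i, hi, hi'⟩ := hc a b hab
        exact ⟨_, fun _ _ => ⟨i, hi, hi', rfl⟩⟩
      · exact ⟨(0, 0), fun ha hb => absurd ⟨ha, hb⟩ hab⟩
    choose p hp using this
    refine ⟨p, ?_, ?_, ?_⟩
    · intro a b ha hb
      obtain ⟨i, -, -, hi⟩ := hp a b ha hb
      exact ⟨i, hi⟩
    · intro a a' b b' haa ha hb hb'
      obtain ⟨i, hi1, hi2, hi⟩ := hp a b (haa.trans ha) hb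
      obtain ⟨j, hj1, hj2, hj⟩ := hp a' b' ha hb'
      rw [hi, hj]
      exact blk_lt haa hi1 hj1
    · intro a a' b b' hbb hb' ha ha'
      obtain ⟨i, hi1, hi2, hi⟩ := hp a b ha (hbb.trans hb')
      obtain ⟨j, hj1, hj2, hj⟩ := hp a' b' ha' hb'
      rw [hi, hj]
      exact blk_lt hbb hi2 hj2
  calc (goodP k g).card * k ^ w ≤ (∑ t ∈ T, (Finset.univ.filter (fun π : Equiv.Perm (Fin k) =>
        ∀ i ∈ blk k w t.1, π i ∉ blk k w t.2)).card) * k ^ w :=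
        Nat.mul_le_mul_right _ ((Finset.card_le_card hsub).trans Finset.card_biUnion_le)
    _ = ∑ t ∈ T, (Finset.univ.filter (fun π : Equiv.Perm (Fin k) =>
        ∀ i ∈ blk k w t.1, π i ∉ blk k w t.2)).card * k ^ w := Finset.sum_mul _ _ _
    _ ≤ ∑ t ∈ T, (k - w) ^ w * k.factorial := by
        apply Finset.sum_le_sum
        intro t ht
        simp only [hT, Finset.mem_product, Finset.mem_range] at ht
        have := avoid_count (blk k w t.2) (blk k w t.1)
        rwa [card_blk h ht.1, card_blk h ht.2] at this
    _ = _ := by simp [hT, sq]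


lemma nz_count {T : Type*} [Fintype T] [DecidableEq T] (Q : ℕ) (s : Finset T) :
    ((Finset.univ.filter (fun ω : T → Fin (Q + 1) => ∀ t ∈ s, ω t ≠ 0)).card : ℝ) =
      ((Q : ℝ) / (Q + 1)) ^ s.card * (Q + 1 : ℝ) ^ Fintype.card T := by
  have e : Finset.univ.filter (fun ω : T → Fin (Q + 1) => ∀ t ∈ s, ω t ≠ 0) =
      Fintype.piFinset (fun t => if t ∈ s then (Finset.univ.erase (0 : Fin (Q + 1))) else Finset.univ) := by
    ext ω
    simp only [Finset.mem_filter, Finset.mem_univ, true_and, Fintype.mem_piFinset]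
    constructor
    · intro h t
      by_cases ht : t ∈ s
      · simp [ht, h t ht]
      · simp [ht]
    · intro h t ht
      have := h t
      simpa [ht] using this
  have hc : ∀ t, ((if t ∈ s then (Finset.univ.erase (0 : Fin (Q + 1))) else Finset.univ).card : ℝ) =
      (if t ∈ s then ((Q : ℝ) / (Q + 1)) else 1) * (Q + 1 : ℝ) := by
    intro t
    have : (Q + 1 : ℝ) ≠ 0 := by positivity
    split_ifs
    · rw [Finset.card_erase_of_mem (Finset.mem_univ _)]
      simp
      field_simp
    · simp
  rw [e, Fintype.card_piFinset, Nat.cast_prod]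
  simp only [hc]
  rw [Finset.prod_mul_distrib, Finset.prod_const, Finset.card_univ, Finset.prod_ite_mem,
    Finset.univ_inter, Finset.prod_const]

lemma dyad1 (R lo hi : ℕ) (h1 : lo < 2 ^ R) (h2 : hi < 2 ^ R) :
    ∃ s, s ≤ R ∧ lo / 2 ^ s = hi / 2 ^ s ∧ (∀ s', s = s' + 1 → lo / 2 ^ s' ≠ hi / 2 ^ s') := by
  have hex : ∃ s, lo / 2 ^ s = hi / 2 ^ s := ⟨R, by rw [Nat.div_eq_of_lt h1, Nat.div_eq_of_lt h2]⟩
  refine ⟨Nat.find hex, Nat.find_min' hex (by rw [Nat.div_eq_of_lt h1, Nat.div_eq_of_lt h2]),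
    Nat.find_spec hex, ?_⟩
  intro s' hs'
  exact Nat.find_min hex (by omega)

lemma dyad (R l : ℕ) (hl : 0 < l) (u : ℕ → ℕ → ℕ) (hu : ∀ a b, a < l → b < l → u a b < 2 ^ R)
    (hlt : ∀ a a' b b', a < a' → a' < l → b < l → b' < l → u a b < u a' b') :
    ∃ s d : ℕ → ℕ, (∀ a, a < l → s a ≤ R) ∧
      (∀ a b, a < l → b < l → u a b / 2 ^ (s a) = d a) ∧
      (∀ a a', a < a' → a' < l → s a = s a' → d a ≠ d a') := by
  have hne : (Finset.range l).Nonempty := ⟨0, Finset.mem_range.mpr hl⟩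
  choose bl hbl hbl' using fun a => Finset.exists_min_image (Finset.range l) (u a) hne
  choose bh hbh hbh' using fun a => Finset.exists_max_image (Finset.range l) (u a) hne
  simp only [Finset.mem_range] at hbl hbl' hbh hbh'
  have : ∀ a, ∃ s, a < l → (s ≤ R ∧ u a (bl a) / 2 ^ s = u a (bh a) / 2 ^ s ∧
      (∀ s', s = s' + 1 → u a (bl a) / 2 ^ s' ≠ u a (bh a) / 2 ^ s')) := by
    intro a
    by_cases ha : a < l
    · obtain ⟨s, hs⟩ := dyad1 R _ _ (hu a (bl a) ha (hbl a)) (hu a (bh a) ha (hbh a))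
      exact ⟨s, fun _ => hs⟩
    · exact ⟨0, fun h => absurd h ha⟩
  choose s hs using this
  refine ⟨s, fun a => u a (bl a) / 2 ^ s a, fun a ha => (hs a ha).1, ?_, ?_⟩
  · intro a b ha hb
    show u a b / 2 ^ s a = u a (bl a) / 2 ^ s a
    apply le_antisymm
    · rw [(hs a ha).2.1]
      exact Nat.div_le_div_right (hbh' a b hb)
    · exact Nat.div_le_div_right (hbl' a b hb)
  · intro a a' haa ha' hss hd
    simp only at hd
    have ha := haa.trans ha'
    obtain ⟨-, e1, n1⟩ := hs a ha
    obtain ⟨-, e2, n2⟩ := hs a' ha'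
    have hlt' := hlt a a' (bh a) (bl a') haa ha' (hbh a) (hbl a')
    rw [← hss] at hd e2 n2
    rcases Nat.eq_zero_or_pos (s a) with h0 | h0
    · rw [h0] at hd
      simp only [pow_zero, Nat.div_one] at hd
      have := hbl' a (bh a) (hbh a)
      omega
    · obtain ⟨s', hs'⟩ := Nat.exists_eq_add_of_lt h0
      have hs'' : s a = s' + 1 := by omega
      have n1' := n1 s' hs''
      have n2' := n2 s' hs''
      have m1 := Nat.div_le_div_right (c := 2 ^ s') (hbl' a (bh a) (hbh a))
      have m2 := Nat.div_le_div_right (c := 2 ^ s') (hbl' a' (bh a') (hbh a'))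
      have m3 := Nat.div_le_div_right (c := 2 ^ s') hlt'.le
      rw [hs''] at hd e1 e2
      simp only [pow_succ, ← Nat.div_div_eq_div_mul] at hd e1 e2
      omega

abbrev DX (R : ℕ) := Fin (R + 1) × Fin (2 ^ R)

def dmk (R : ℕ) (s : Fin (R + 1)) (i : ℕ) : DX R :=
  (s, ⟨(i / 2 ^ (s : ℕ)) % 2 ^ R, Nat.mod_lt _ (by positivity)⟩)

def Aset {R Q : ℕ} (ω : DX R × DX R → Fin (Q + 1)) : Finset (ℕ × ℕ) :=
  (box (2 ^ R)).filter (fun q => ∀ s t : Fin (R + 1), ω (dmk R s q.1, dmk R t q.2) ≠ 0)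

lemma dyadX (R l : ℕ) (hl : 0 < l) (u : ℕ → ℕ → ℕ) (hu : ∀ a b, a < l → b < l → u a b < 2 ^ R)
    (hlt : ∀ a a' b b', a < a' → a' < l → b < l → b' < l → u a b < u a' b') :
    ∃ D : Fin l → DX R, Function.Injective D ∧ ∀ a b : Fin l, ∃ s, D a = dmk R s (u a b) := by
  obtain ⟨s, d, h1, h2, h3⟩ := dyad R l hl u hu hlt
  have hd : ∀ a, a < l → d a < 2 ^ R := by
    intro a ha
    rw [← h2 a 0 ha hl]
    exact lt_of_le_of_lt (Nat.div_le_self _ _) (hu a 0 ha hl)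
  refine ⟨fun a => (⟨s a, Nat.lt_succ_of_le (h1 a a.2)⟩, ⟨d a, hd a a.2⟩), ?_, ?_⟩
  · intro a a' h
    simp only [Prod.mk.injEq, Fin.mk.injEq] at h
    rcases lt_trichotomy a a' with hh | hh | hh
    · exact absurd h.2 (h3 a a' hh a'.2 h.1)
    · exact hh
    · exact absurd h.2.symm (h3 a' a hh a.2 h.1.symm)
  · intro a b
    refine ⟨⟨s a, Nat.lt_succ_of_le (h1 a a.2)⟩, ?_⟩
    simp only [dmk, Prod.mk.injEq, Fin.mk.injEq, true_and]
    rw [h2 a b a.2 b.2, Nat.mod_eq_of_lt (hd a a.2)]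

lemma grid_DX {R Q l : ℕ} (hl : 0 < l) (ω : DX R × DX R → Fin (Q + 1)) (h : HasGrid (Aset ω) l) :
    ∃ D E : Fin l → DX R, Function.Injective D ∧ Function.Injective E ∧
      ∀ a b, ω (D a, E b) ≠ 0 := by
  obtain ⟨p, h1, h2, h3⟩ := h
  have hm : ∀ a b, a < l → b < l → ((p a b).1 < 2 ^ R ∧ (p a b).2 < 2 ^ R) ∧
      ∀ s t : Fin (R + 1), ω (dmk R s (p a b).1, dmk R t (p a b).2) ≠ 0 := by
    intro a b ha hb
    have := h1 a b ha hb
    rw [Finset.mem_coe, Aset, Finset.mem_filter, mem_box] at this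
    exact this
  obtain ⟨D, hD, hD'⟩ := dyadX R l hl (fun a b => (p a b).1) (fun a b ha hb => (hm a b ha hb).1.1) h2
  obtain ⟨E, hE, hE'⟩ := dyadX R l hl (fun b a => (p a b).2) (fun b a hb ha => (hm a b ha hb).1.2)
    (fun b b' a a' hbb hb ha ha' => h3 a a' b b' hbb hb ha ha')
  refine ⟨D, E, hD, hE, fun a b => ?_⟩
  obtain ⟨s, hs⟩ := hD' a b
  obtain ⟨t, ht⟩ := hE' b a
  rw [hs, ht]
  exact (hm a b a.2 b.2).2 s t

lemma bad_count {R Q l : ℕ} (hl : 0 < l) (B : Finset (DX R × DX R → Fin (Q + 1)))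
    (hB : ∀ ω ∈ B, HasGrid (Aset ω) l) :
    (B.card : ℝ) ≤ ((((R + 1) * 2 ^ R : ℕ) : ℝ) ^ l) ^ 2 *
      (((Q : ℝ) / (Q + 1)) ^ (l * l) * (Q + 1 : ℝ) ^ Fintype.card (DX R × DX R)) := by
  classical
  set T : Finset ((Fin l → DX R) × (Fin l → DX R)) :=
    Finset.univ.filter (fun t => Function.Injective t.1 ∧ Function.Injective t.2) with hT
  let F : ((Fin l → DX R) × (Fin l → DX R)) → Finset (DX R × DX R) := fun t =>
    Finset.univ.image (fun ab : Fin l × Fin l => (t.1 ab.1, t.2 ab.2))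
  have hsub : B ⊆ T.biUnion (fun t => Finset.univ.filter
      (fun ω : DX R × DX R → Fin (Q + 1) => ∀ x ∈ F t, ω x ≠ 0)) := by
    intro ω hω
    obtain ⟨D, E, hD, hE, h⟩ := grid_DX hl ω (hB ω hω)
    simp only [Finset.mem_biUnion, hT, F, Finset.mem_filter, Finset.mem_univ, true_and]
    refine ⟨(D, E), ⟨hD, hE⟩, ?_⟩
    intro x hx
    obtain ⟨ab, -, rfl⟩ := Finset.mem_image.mp hx
    exact h _ _
  have hFc : ∀ t ∈ T, (F t).card = l * l := by
    intro t ht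
    simp only [hT, Finset.mem_filter, Finset.mem_univ, true_and] at ht
    rw [Finset.card_image_of_injective]
    · simp
    · intro x y h
      simp only [Prod.mk.injEq] at h
      exact Prod.ext (ht.1 h.1) (ht.2 h.2)
  have hTc : (T.card : ℝ) ≤ ((((R + 1) * 2 ^ R : ℕ) : ℝ) ^ l) ^ 2 := by
    have : T.card ≤ Fintype.card ((Fin l → DX R) × (Fin l → DX R)) := Finset.card_le_univ _
    have e : Fintype.card ((Fin l → DX R) × (Fin l → DX R)) = (((R + 1) * 2 ^ R) ^ l) ^ 2 := by
      simp [sq]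
    rw [e] at this
    exact_mod_cast this
  have h1 : (B.card : ℝ) ≤ ∑ t ∈ T, ((Finset.univ.filter
      (fun ω : DX R × DX R → Fin (Q + 1) => ∀ x ∈ F t, ω x ≠ 0)).card : ℝ) := by
    exact_mod_cast (Finset.card_le_card hsub).trans Finset.card_biUnion_le
  refine h1.trans ?_
  rw [Finset.sum_congr rfl (fun t ht => by rw [nz_count Q (F t), hFc t ht]), Finset.sum_const,
    nsmul_eq_mul]
  gcongr

lemma mass_sum (R Q : ℕ) :
    ∑ ω : DX R × DX R → Fin (Q + 1), ((Aset ω).card : ℝ) =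
      ((2 ^ R * 2 ^ R : ℕ) : ℝ) * (((Q : ℝ) / (Q + 1)) ^ ((R + 1) * (R + 1)) *
        (Q + 1 : ℝ) ^ Fintype.card (DX R × DX R)) := by
  classical
  let F : ℕ × ℕ → Finset (DX R × DX R) := fun q =>
    Finset.univ.image (fun st : Fin (R + 1) × Fin (R + 1) => (dmk R st.1 q.1, dmk R st.2 q.2))
  have hFc : ∀ q, (F q).card = (R + 1) * (R + 1) := by
    intro q
    rw [Finset.card_image_of_injective]
    · simp
    · intro x y h
      simp only [dmk, Prod.mk.injEq] at h
      exact Prod.ext h.1.1 h.2.1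
  have e1 : ∀ ω : DX R × DX R → Fin (Q + 1), ((Aset ω).card : ℝ) =
      ∑ q ∈ box (2 ^ R), if (∀ x ∈ F q, ω x ≠ 0) then (1 : ℝ) else 0 := by
    intro ω
    rw [Finset.sum_boole]
    congr 2
    unfold Aset
    apply Finset.filter_congr
    intro q _
    simp only [F, Finset.mem_image, Finset.mem_univ, true_and, Prod.exists, forall_exists_index]
    constructor
    · rintro h x s t rfl
      exact h s t
    · intro h s t
      exact h _ s t rfl
  simp only [e1]
  rw [Finset.sum_comm]
  have e2 : ∀ q ∈ box (2 ^ R), (∑ ω : DX R × DX R → Fin (Q + 1),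
      if (∀ x ∈ F q, ω x ≠ 0) then (1 : ℝ) else 0) =
      ((Q : ℝ) / (Q + 1)) ^ ((R + 1) * (R + 1)) * (Q + 1 : ℝ) ^ Fintype.card (DX R × DX R) := by
    intro q _
    rw [Finset.sum_boole, nz_count Q (F q), hFc]
  rw [Finset.sum_congr rfl e2, Finset.sum_const, card_box, nsmul_eq_mul]

lemma exists_A (R Q l : ℕ) (hl : 0 < l) (hQ : 0 < Q)
    (hcond : ((((R + 1) * 2 ^ R : ℕ) : ℝ) ^ l) ^ 2 * ((Q : ℝ) / (Q + 1)) ^ (l * l) ≤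
      ((Q : ℝ) / (Q + 1)) ^ ((R + 1) * (R + 1)) / 2) :
    ∃ A : Finset (ℕ × ℕ), A ⊆ box (2 ^ R) ∧ ¬ HasGrid A l ∧
      ((2 ^ R * 2 ^ R : ℕ) : ℝ) * ((Q : ℝ) / (Q + 1)) ^ ((R + 1) * (R + 1)) / 2 ≤ A.card := by
  classical
  by_contra hc
  push Not at hc
  set W := (Q + 1 : ℝ) ^ Fintype.card (DX R × DX R) with hW
  set P := ((Q : ℝ) / (Q + 1)) ^ ((R + 1) * (R + 1)) with hP
  set V := ((2 ^ R * 2 ^ R : ℕ) : ℝ) with hV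
  have hWpos : 0 < W := by positivity
  have hVpos : 0 < V := by positivity
  set B := Finset.univ.filter (fun ω : DX R × DX R → Fin (Q + 1) => HasGrid (Aset ω) l) with hB
  have hbad := bad_count hl B (fun ω hω => (Finset.mem_filter.mp hω).2)
  have hBW : (B.card : ℝ) ≤ P / 2 * W := by
    refine hbad.trans ?_
    rw [← mul_assoc]
    exact mul_le_mul_of_nonneg_right hcond hWpos.le
  have hsum := mass_sum R Q
  have hle : ∀ ω : DX R × DX R → Fin (Q + 1), ((Aset ω).card : ℝ) ≤
      V * P / 2 + (if HasGrid (Aset ω) l then V else 0) := by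
    intro ω
    have hsubb : Aset ω ⊆ box (2 ^ R) := Finset.filter_subset _ _
    split_ifs with h
    · have h1 := Finset.card_le_card hsubb
      rw [card_box] at h1
      have h2 : ((Aset ω).card : ℝ) ≤ V := by rw [hV]; exact_mod_cast h1
      have : 0 ≤ V * P / 2 := by positivity
      linarith
    · have := hc (Aset ω) hsubb h
      linarith
  -- strict for one `ω`, the constant one
  have hlt : ∑ ω : DX R × DX R → Fin (Q + 1), ((Aset ω).card : ℝ) <
      ∑ ω : DX R × DX R → Fin (Q + 1), (V * P / 2 + (if HasGrid (Aset ω) l then V else 0)) := by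
    apply Finset.sum_lt_sum (fun ω _ => hle ω)
    refine ⟨fun _ => 0, Finset.mem_univ _, ?_⟩
    have hem : Aset (fun _ : DX R × DX R => (0 : Fin (Q + 1))) = ∅ := by
      simp [Aset]
    have hPpos : 0 < P := by positivity
    have : 0 < V * P / 2 := by positivity
    have : 0 ≤ (if HasGrid (Aset (fun _ : DX R × DX R => (0 : Fin (Q + 1)))) l then V else 0) := by
      split_ifs
      · exact hVpos.le
      · exact le_rfl
    rw [show ((Aset (fun _ : DX R × DX R => (0 : Fin (Q + 1)))).card : ℝ) = 0 by rw [hem]; simp]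
    linarith
  rw [hsum, Finset.sum_add_distrib, ← Finset.sum_filter, Finset.sum_const, Finset.sum_const,
    nsmul_eq_mul, nsmul_eq_mul, Finset.card_univ] at hlt
  have hcardΩ : ((Fintype.card (DX R × DX R → Fin (Q + 1)) : ℕ) : ℝ) = W := by
    rw [Fintype.card_fun, Fintype.card_fin, hW]; push_cast; rfl
  rw [hcardΩ] at hlt
  have : (B.card : ℝ) * V ≤ P / 2 * W * V := mul_le_mul_of_nonneg_right hBW hVpos.le
  have e : V * (P * W) = W * (V * P / 2) + P / 2 * W * V := by ring
  linarith

lemma two_mul_le_two_pow (h : ℕ) : 4 * h ≤ 2 ^ (4 * h) := (Nat.lt_two_pow_self).le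

lemma dyadic_main (h : ℕ) (hh : 0 < h) : ∃ A : Finset (ℕ × ℕ), A ⊆ box (2 ^ (4 * h - 1)) ∧
    ¬ HasGrid A (1024 * h ^ 2) ∧ 2 ^ (2 * (4 * h - 1)) ≤ A.card * 2 ^ (h + 1) := by
  obtain ⟨R, hR⟩ : ∃ R, R + 1 = 4 * h := ⟨4 * h - 1, by omega⟩
  have hR' : 4 * h - 1 = R := by omega
  rw [hR']
  obtain ⟨Q, hQ⟩ : ∃ Q, Q + 1 = 32 * h := ⟨32 * h - 1, by omega⟩
  have hQr : (Q : ℝ) + 1 = 32 * h := by exact_mod_cast hQ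
  have hhr : (1 : ℝ) ≤ h := by exact_mod_cast hh
  set ρ := (Q : ℝ) / (Q + 1) with hρ
  have hρ1 : ρ = 1 + (-(1 / (32 * h : ℝ))) := by
    rw [hρ, hQr]
    field_simp
    linarith
  have hρ0 : 0 ≤ ρ := by positivity
  have hsmall : 1 / (32 * h : ℝ) ≤ 1 := by
    rw [div_le_one (by positivity)]; linarith
  have hlow : (1 / 2 : ℝ) ≤ ρ ^ (16 * h) := by
    have := one_add_mul_le_pow (a := (-(1 / (32 * h : ℝ)))) (by linarith) (16 * h)
    rw [← hρ1] at this
    refine le_trans (le_of_eq ?_) this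
    push_cast
    field_simp
    norm_num
  have hup : ρ ^ (32 * h) ≤ 1 / 2 := by
    have h1 : ρ ≤ Real.exp (-(1 / (32 * h : ℝ))) := by
      rw [hρ1]; linarith [Real.add_one_le_exp (-(1 / (32 * h : ℝ)))]
    have h2 : ρ ^ (32 * h) ≤ Real.exp (-1) := by
      refine (pow_le_pow_left₀ hρ0 h1 _).trans (le_of_eq ?_)
      rw [← Real.exp_nat_mul]
      congr 1
      push_cast
      field_simp
    refine h2.trans ?_
    rw [Real.exp_neg, one_div]
    apply inv_anti₀ (by norm_num)
    linarith [Real.add_one_le_exp (1 : ℝ)]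
  have hP : (1 / 2 : ℝ) ^ h ≤ ρ ^ ((R + 1) * (R + 1)) := by
    have : (R + 1) * (R + 1) = (16 * h) * h := by rw [hR]; ring
    rw [this, pow_mul]
    exact pow_le_pow_left₀ (by norm_num) hlow _
  have hX : (((R + 1) * 2 ^ R : ℕ) : ℝ) ≤ 2 ^ (8 * h) := by
    have h1 : (R + 1) * 2 ^ R ≤ 2 ^ (4 * h) * 2 ^ (4 * h) := by
      apply Nat.mul_le_mul
      · rw [hR]; exact two_mul_le_two_pow h
      · exact Nat.pow_le_pow_right (by norm_num) (by omega)
    rw [← pow_add, show 4 * h + 4 * h = 8 * h by ring] at h1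
    exact_mod_cast h1
  have hcond : ((((R + 1) * 2 ^ R : ℕ) : ℝ) ^ (1024 * h ^ 2)) ^ 2 *
      ρ ^ ((1024 * h ^ 2) * (1024 * h ^ 2)) ≤ ρ ^ ((R + 1) * (R + 1)) / 2 := by
    have h1 : ((((R + 1) * 2 ^ R : ℕ) : ℝ) ^ (1024 * h ^ 2)) ^ 2 ≤ 2 ^ (16384 * h ^ 3) := by
      calc _ ≤ ((2 ^ (8 * h) : ℝ) ^ (1024 * h ^ 2)) ^ 2 := by gcongr
        _ = 2 ^ (16384 * h ^ 3) := by
          rw [← pow_mul, ← pow_mul]; congr 1; ring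
    have h2 : ρ ^ ((1024 * h ^ 2) * (1024 * h ^ 2)) ≤ (1 / 2) ^ (32768 * h ^ 3) := by
      have : (1024 * h ^ 2) * (1024 * h ^ 2) = (32 * h) * (32768 * h ^ 3) := by ring
      rw [this, pow_mul]
      exact pow_le_pow_left₀ (by positivity) hup _
    calc _ ≤ (2 : ℝ) ^ (16384 * h ^ 3) * (1 / 2) ^ (32768 * h ^ 3) := by gcongr
      _ = (1 / 2) ^ (16384 * h ^ 3) := by
          rw [show 32768 * h ^ 3 = 16384 * h ^ 3 + 16384 * h ^ 3 by ring, pow_add, ← mul_assoc,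
            ← mul_pow]
          norm_num
      _ ≤ (1 / 2) ^ (h + 1) := by
          apply pow_le_pow_of_le_one (by norm_num) (by norm_num)
          have : h ≤ h ^ 3 := Nat.le_self_pow (by norm_num) h
          omega
      _ = (1 / 2) ^ h / 2 := by rw [pow_succ]; ring
      _ ≤ _ := by linarith
  obtain ⟨A, hA1, hA2, hA3⟩ := exists_A R Q (1024 * h ^ 2) (by positivity) (by omega) hcond
  refine ⟨A, hA1, hA2, ?_⟩
  have h4 : ((2 ^ R * 2 ^ R : ℕ) : ℝ) * (1 / 2) ^ h / 2 ≤ A.card := by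
    refine le_trans ?_ hA3
    gcongr
  have h5 : ((2 ^ R * 2 ^ R : ℕ) : ℝ) ≤ A.card * 2 ^ (h + 1) := by
    have : ((2 ^ R * 2 ^ R : ℕ) : ℝ) = (((2 ^ R * 2 ^ R : ℕ) : ℝ) * (1 / 2) ^ h / 2) * 2 ^ (h + 1) := by
      have : ((1 : ℝ) / 2) ^ h * 2 ^ h = 1 := by rw [← mul_pow]; norm_num
      rw [pow_succ]
      linear_combination -(((2 ^ R * 2 ^ R : ℕ) : ℝ)) * this
    rw [this]
    gcongr
  rw [two_mul, pow_add]
  exact_mod_cast h5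


lemma goodP_main (h : ℕ) (hh : 7 ≤ h) :
    2 ^ ((3 * h - 7) * 2 ^ (4 * h - 1)) ≤ (goodP (2 ^ (4 * h - 1)) (3 * (1024 * h ^ 2))).card := by
  obtain ⟨A, hA1, hA2, hA3⟩ := dyadic_main h (by omega)
  set m := 2 ^ (4 * h - 1) with hm
  have h1 := choose_le_goodP (N := m) A hA1 hA2
  set G := (goodP m (3 * (1024 * h ^ 2))).card with hG
  have h2 : 2 ^ (7 * h - 3) ≤ A.card := by
    have : 2 ^ (2 * (4 * h - 1)) = 2 ^ (7 * h - 3) * 2 ^ (h + 1) := by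
      rw [← pow_add]; congr 1; omega
    rw [this] at hA3
    exact Nat.le_of_mul_le_mul_right hA3 (by positivity)
  have h3 : m ≤ 2 ^ (7 * h - 4) := Nat.pow_le_pow_right (by norm_num) (by omega)
  have h4 : 2 ^ (7 * h - 3) = 2 * 2 ^ (7 * h - 4) := by
    rw [← pow_succ']; congr 1; omega
  have h5 : 2 ^ (7 * h - 4) ≤ A.card + 1 - m := by omega
  have h6 : (A.card + 1 - m) ^ m ≤ m ^ m * A.card.choose m := by
    have e := Nat.pow_sub_le_descFactorial A.card m
    rw [Nat.descFactorial_eq_factorial_mul_choose] at e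
    exact e.trans (Nat.mul_le_mul_right _ (Nat.factorial_le_pow m))
  have h7 : 2 ^ ((7 * h - 4) * m) ≤ 2 ^ ((4 * h + 3) * m) * G := by
    calc 2 ^ ((7 * h - 4) * m) = (2 ^ (7 * h - 4)) ^ m := by rw [pow_mul]
      _ ≤ (A.card + 1 - m) ^ m := Nat.pow_le_pow_left h5 m
      _ ≤ m ^ m * A.card.choose m := h6
      _ ≤ m ^ m * (G * (2 ^ (m + m) * 2 ^ (m + m))) := Nat.mul_le_mul_left _ h1
      _ = 2 ^ ((4 * h + 3) * m) * G := by
        have : m ^ m = 2 ^ ((4 * h - 1) * m) := by rw [pow_mul, ← hm]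
        rw [this]
        have : (4 * h + 3) * m = (4 * h - 1) * m + (m + m) + (m + m) := by
          rw [show 4 * h + 3 = (4 * h - 1) + 4 by omega]; ring
        rw [this, pow_add _ (_ + _), pow_add _ _ (m + m)]
        ring
  have h8 : (7 * h - 4) * m = (4 * h + 3) * m + (3 * h - 7) * m := by
    rw [← add_mul]; congr 1; omega
  rw [h8, pow_add] at h7
  exact Nat.le_of_mul_le_mul_left h7 (by positivity)

lemma SU_lower {k h : ℕ} (hh : 7 ≤ h) (U : Finset (Equiv.Perm (Fin k)))
    (hU : ∀ π ∈ U, HasGrid (pgraph π) (3 * (1024 * h ^ 2) + 2)) (n : ℕ)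
    (hn : 2 * 2 ^ (4 * h - 1) ≤ n) : 2 ^ (h * n) ≤ SU n U := by
  set m := 2 ^ (4 * h - 1) with hm
  have hmpos : 0 < m := by positivity
  have hL : 2 ≤ 3 * (1024 * h ^ 2) := by
    have : 1 ≤ h ^ 2 := Nat.one_le_pow _ _ (by omega)
    omega
  have h1 := goodP_pow (n := n) hL hmpos (Nat.div_mul_le_self n m)
  refine le_trans ?_ (h1.trans (goodP_le_SU U hU))
  have h2 := Nat.pow_le_pow_left (goodP_main h hh) (n / m)
  refine le_trans ?_ h2
  rw [← hm, ← pow_mul]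
  apply Nat.pow_le_pow_right (by norm_num)
  have h3 := Nat.div_add_mod n m
  have h4 := Nat.mod_lt n hmpos
  have h5 : n ≤ 2 * (m * (n / m)) := by omega
  calc h * n ≤ h * (2 * (m * (n / m))) := Nat.mul_le_mul_left _ h5
    _ = (2 * h) * (m * (n / m)) := by ring
    _ ≤ (3 * h - 7) * (m * (n / m)) := Nat.mul_le_mul_right _ (by omega)
    _ = _ := by ring

lemma liminf_bound {k h : ℕ} (hh : 7 ≤ h) (U : Finset (Equiv.Perm (Fin k))) (hne : U.Nonempty)
    (hU : ∀ π ∈ U, HasGrid (pgraph π) (3 * (1024 * h ^ 2) + 2)) :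
    (2 : ℝ) ^ (h : ℝ) ≤ liminf (fun n : ℕ => (SU n U : ℝ) ^ ((1 : ℝ) / (n : ℝ))) atTop := by
  apply le_liminf_of_le
  · obtain ⟨M, b, hb, hM⟩ := SU_upper U hne
    refine IsCoboundedUnder.of_frequently_le (a := (2 : ℝ) ^ (M : ℝ)) ?_
    rw [frequently_atTop]
    intro N
    refine ⟨b ^ N, (Nat.lt_pow_self (by omega)).le, ?_⟩
    have hpos : (0 : ℝ) < ((b ^ N : ℕ) : ℝ) := by
      have : 0 < b ^ N := by positivity
      exact_mod_cast this
    have h1 : (SU (b ^ N) U : ℝ) ≤ (2 : ℝ) ^ (M * b ^ N) := by exact_mod_cast hM N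
    calc (SU (b ^ N) U : ℝ) ^ ((1 : ℝ) / ((b ^ N : ℕ) : ℝ))
        ≤ ((2 : ℝ) ^ (M * b ^ N)) ^ ((1 : ℝ) / ((b ^ N : ℕ) : ℝ)) :=
          Real.rpow_le_rpow (by positivity) h1 (by positivity)
      _ = (2 : ℝ) ^ (M : ℝ) := by
          rw [← Real.rpow_natCast, ← Real.rpow_mul (by norm_num)]
          congr 1
          rw [Nat.cast_mul]
          field_simp
  · filter_upwards [eventually_ge_atTop (2 * 2 ^ (4 * h - 1))] with n hn
    have h1 : (2 : ℝ) ^ (h * n) ≤ SU n U := by exact_mod_cast SU_lower hh U hU n hn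
    have hpos : (0 : ℝ) < (n : ℝ) := by
      have : 0 < 2 ^ (4 * h - 1) := by positivity
      exact_mod_cast (by omega : 0 < n)
    calc (2 : ℝ) ^ (h : ℝ) = ((2 : ℝ) ^ (h * n)) ^ ((1 : ℝ) / n) := by
          rw [← Real.rpow_natCast, ← Real.rpow_mul (by norm_num)]
          congr 1
          rw [Nat.cast_mul]
          field_simp
      _ ≤ _ := Real.rpow_le_rpow (by positivity) h1 (by positivity)

lemma goodP_small {k g : ℕ} {y : ℝ} (hk : 2 ≤ k) (hg : 1 ≤ g) (hy : Real.log k ≤ y)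
    (hgk : 169 * (g : ℝ) ^ 2 * y ≤ k) (hy1 : 1 ≤ y) :
    ((goodP k g).card : ℝ) ≤ (1 / k) * k.factorial := by
  have hkr : (2 : ℝ) ≤ k := by exact_mod_cast hk
  have hgr : (1 : ℝ) ≤ g := by exact_mod_cast hg
  have hg2 : (g : ℝ) ^ 2 ≤ k := by nlinarith [sq_nonneg (g : ℝ)]
  have hg2' : 169 * (g : ℝ) ^ 2 ≤ k := by nlinarith [sq_nonneg (g : ℝ)]
  set w := k / g with hw
  have hgw : g * w ≤ k := Nat.mul_div_le k g
  have h1 := goodP_card hgw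
  have hwr : (k : ℝ) ≤ 2 * (g * w) := by
    have e1 := Nat.div_add_mod k g
    have e2 := Nat.mod_lt k hg
    have e3 : (k : ℝ) ≤ g * w + g := by
      have : k ≤ g * w + g := by rw [hw]; omega
      exact_mod_cast this
    nlinarith
  have hwk : w ≤ k := Nat.div_le_self _ _
  have h1r : ((goodP k g).card : ℝ) * (k : ℝ) ^ w ≤ (g : ℝ) ^ 2 * (((k : ℝ) - w) ^ w * k.factorial) := by
    have := h1
    have e : ((k - w : ℕ) : ℝ) = (k : ℝ) - w := by push_cast [hwk]; ring
    rw [← e]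
    exact_mod_cast this
  have hexp : ((k : ℝ) - w) ^ w ≤ (k : ℝ) ^ w * (1 / k ^ 2) := by
    have hle : 1 - (w : ℝ) / k ≤ Real.exp (-((w : ℝ) / k)) := by
      linarith [Real.add_one_le_exp (-((w : ℝ) / k))]
    have hnn : 0 ≤ 1 - (w : ℝ) / k := by
      have : (w : ℝ) / k ≤ 1 := by
        rw [div_le_one (by linarith)]; exact_mod_cast hwk
      linarith
    have e1 : (k : ℝ) - w = k * (1 - (w : ℝ) / k) := by field_simp
    rw [e1, mul_pow]
    apply mul_le_mul_of_nonneg_left _ (by positivity)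
    refine (pow_le_pow_left₀ hnn hle w).trans ?_
    rw [← Real.exp_nat_mul]
    have e2 : (1 : ℝ) / k ^ 2 = Real.exp (-(2 * Real.log k)) := by
      rw [Real.exp_neg, two_mul, Real.exp_add, Real.exp_log (by linarith), one_div, sq]
    rw [e2]
    apply Real.exp_le_exp.mpr
    have e3 : 2 * Real.log k ≤ w * ((w : ℝ) / k) := by
      rw [← mul_div_assoc, le_div_iff₀ (by linarith)]
      -- 2 y k ≤ w^2 ; k^2 ≤ 4 g^2 w^2 ; 169 g^2 y ≤ k
      have f1 : (k : ℝ) ^ 2 ≤ 4 * (g : ℝ) ^ 2 * (w * w) := by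
        have : (k : ℝ) ^ 2 ≤ (2 * (g * w)) ^ 2 := pow_le_pow_left₀ (by linarith) hwr 2
        linarith [this, (by ring : (2 * ((g : ℝ) * w)) ^ 2 = 4 * (g : ℝ) ^ 2 * (w * w))]
      have f2 : 169 * (g : ℝ) ^ 2 * y * k ≤ k * k := mul_le_mul_of_nonneg_right hgk (by linarith)
      have f3 : (g : ℝ) ^ 2 * (169 * y * k) ≤ (g : ℝ) ^ 2 * (4 * (w * w)) := by
        nlinarith
      have f4 : 169 * y * k ≤ 4 * (w * w) := le_of_mul_le_mul_left f3 (by positivity)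
      have f5 : 2 * Real.log k * k ≤ 2 * y * k := by gcongr
      have : 0 ≤ y * k := by positivity
      linarith
    linarith
  have hkw : (0 : ℝ) < (k : ℝ) ^ w := by positivity
  have hfin : ((goodP k g).card : ℝ) * (k : ℝ) ^ w ≤ ((1 / k) * k.factorial) * (k : ℝ) ^ w := by
    refine h1r.trans ?_
    calc (g : ℝ) ^ 2 * (((k : ℝ) - w) ^ w * k.factorial)
        ≤ k * (((k : ℝ) ^ w * (1 / k ^ 2)) * k.factorial) := by
          apply mul_le_mul hg2 _ _ (by linarith)
          · exact mul_le_mul_of_nonneg_right hexp (by positivity)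
          · apply mul_nonneg _ (by positivity)
            apply pow_nonneg
            have : (w : ℝ) ≤ k := by exact_mod_cast hwk
            linarith
      _ = _ := by field_simp
  exact le_of_mul_le_mul_right hfin hkw


/-- There is an absolute constant `c > 0` such that for every
`0 < ε < 1` there exists `K` such that for every `k ≥ K` there is a set `U` of
`k`-permutations with `|U| ≥ (1−ε)·k!` and
`liminf_{n→∞} S_n(U)^{1/n} ≥ 2^{c·(k/log₂ k)^{1/4}}`. -/
theorem stmt1 :
    ∃ c : ℝ, 0 < c ∧ ∀ ε : ℝ, 0 < ε → ε < 1 → ∃ K : ℕ, ∀ k : ℕ, K ≤ k →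
      ∃ U : Finset (Equiv.Perm (Fin k)),
        (1 - ε) * (Nat.factorial k : ℝ) ≤ (U.card : ℝ) ∧
        (2 : ℝ) ^ (c * ((k : ℝ) / Real.logb 2 (k : ℝ)) ^ ((1 : ℝ) / 4)) ≤
          liminf (fun n : ℕ => (SU n U : ℝ) ^ ((1 : ℝ) / (n : ℝ))) atTop := by
  classical
  refine ⟨1 / 400, by norm_num, fun ε hε hε1 => ?_⟩
  refine ⟨max (⌈1 / ε⌉₊) ((4 * 2800 ^ 4) ^ 2), fun k hk => ?_⟩
  have hk1 : 1 / ε ≤ k := (Nat.le_ceil _).trans (by exact_mod_cast (le_max_left _ _).trans hk)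
  have hk2 : (4 * 2800 ^ 4) ^ 2 ≤ k := (le_max_right _ _).trans hk
  have hk2r : ((4 * 2800 ^ 4) ^ 2 : ℝ) ≤ k := by exact_mod_cast hk2
  have hkpos : (0 : ℝ) < k := lt_of_lt_of_le (by norm_num) hk2r
  have hl2 : 1 / 2 ≤ Real.log 2 := by linarith [Real.log_two_gt_d9]
  have hl2' : Real.log 2 ≤ 1 := by linarith [Real.log_two_lt_d9]
  set y := Real.logb 2 (k : ℝ) with hy
  have hylog : Real.log k = y * Real.log 2 := by
    rw [hy, Real.logb]; field_simp
  have hlogk : 1 ≤ Real.log k := by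
    rw [Real.le_log_iff_exp_le hkpos]
    linarith [Real.exp_one_lt_d9, (by norm_num : (3 : ℝ) ≤ (4 * 2800 ^ 4) ^ 2)]
  have hy0 : 0 < y := by
    by_contra hc
    nlinarith
  have hlogy : Real.log k ≤ y := by nlinarith
  have hy1 : 1 ≤ y := hlogk.trans hlogy
  have hysq : y ≤ 4 * Real.sqrt k := by
    have hs : 0 < Real.sqrt k := Real.sqrt_pos.mpr hkpos
    have h1 : Real.log k = 2 * Real.log (Real.sqrt k) := by
      rw [Real.log_sqrt hkpos.le]; ring
    have h2 := Real.log_le_sub_one_of_pos hs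
    nlinarith
  set X := (k : ℝ) / y with hX
  have hXy : X * y = k := by rw [hX]; field_simp
  have hXbig : (2800 : ℝ) ^ 4 ≤ X := by
    rw [hX, le_div_iff₀ hy0]
    have hs : (4 * 2800 ^ 4 : ℝ) ≤ Real.sqrt k := Real.le_sqrt_of_sq_le hk2r
    have hss : Real.sqrt k * Real.sqrt k = k := Real.mul_self_sqrt hkpos.le
    have hs0 : 0 ≤ Real.sqrt k := Real.sqrt_nonneg _
    calc (2800 : ℝ) ^ 4 * y ≤ 2800 ^ 4 * (4 * Real.sqrt k) := by gcongr
      _ = (4 * 2800 ^ 4) * Real.sqrt k := by ring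
      _ ≤ Real.sqrt k * Real.sqrt k := by gcongr
      _ = k := hss
  have hX0 : 0 ≤ X := le_trans (by positivity) hXbig
  set x := X ^ ((1 : ℝ) / 4) with hx
  have hx0 : 0 ≤ x := Real.rpow_nonneg hX0 _
  have hx4 : x ^ 4 = X := by
    rw [hx, ← Real.rpow_natCast, ← Real.rpow_mul hX0]
    norm_num
  have hxbig : 2800 ≤ x := by
    by_contra hc
    push Not at hc
    have := pow_lt_pow_left₀ hc hx0 (n := 4) (by norm_num)
    linarith
  set h := ⌊x / 200⌋₊ with hh
  have hh1 : (h : ℝ) ≤ x / 200 := Nat.floor_le (by positivity)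
  have hh2 : x / 200 < h + 1 := Nat.lt_floor_add_one _
  have hh7 : 7 ≤ h := by
    apply Nat.le_floor
    push_cast; linarith
  have hhx : 1 / 400 * x ≤ h := by linarith
  set g := 3 * (1024 * h ^ 2) + 2 with hg
  have hgx : (g : ℝ) ≤ x ^ 2 / 13 := by
    have h1 : (1 : ℝ) ≤ h := by exact_mod_cast (by omega : 1 ≤ h)
    have h2 : (h : ℝ) ^ 2 ≤ (x / 200) ^ 2 := pow_le_pow_left₀ (by positivity) hh1 2
    rw [hg]; push_cast
    nlinarith
  have hgk : 169 * (g : ℝ) ^ 2 * y ≤ k := by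
    have h1 : (g : ℝ) ^ 2 ≤ (x ^ 2 / 13) ^ 2 := pow_le_pow_left₀ (by positivity) hgx 2
    have h2 : (x ^ 2 / 13) ^ 2 = X / 169 := by rw [← hx4]; ring
    rw [h2] at h1
    calc 169 * (g : ℝ) ^ 2 * y ≤ 169 * (X / 169) * y := by gcongr
      _ = X * y := by ring
      _ = k := hXy
  have hsmall := goodP_small (k := k) (g := g) (y := y)
    (le_trans (by norm_num) hk2) (by omega) hlogy hgk hy1
  set U := Finset.univ.filter (fun π : Equiv.Perm (Fin k) => HasGrid (pgraph π) g) with hU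
  have hcard : (U.card : ℝ) + (goodP k g).card = k.factorial := by
    have h1 : U.card + (Finset.univ.filter
        (fun π : Equiv.Perm (Fin k) => ¬ HasGrid (pgraph π) g)).card = k.factorial := by
      rw [hU, Finset.card_filter_add_card_filter_not, Finset.card_univ, Fintype.card_perm,
        Fintype.card_fin]
    have h2 : goodP k g = Finset.univ.filter
        (fun π : Equiv.Perm (Fin k) => ¬ HasGrid (pgraph π) g) := by
      ext π; simp [mem_goodP]
    rw [h2]
    exact_mod_cast h1
  have hfpos : (0 : ℝ) < k.factorial := by exact_mod_cast Nat.factorial_pos k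
  have hle : (1 / (k : ℝ)) * k.factorial ≤ ε * k.factorial := by
    apply mul_le_mul_of_nonneg_right _ hfpos.le
    rw [div_le_iff₀ hkpos]
    rw [div_le_iff₀ hε] at hk1
    linarith
  have hUc : (1 - ε) * (k.factorial : ℝ) ≤ U.card := by linarith
  refine ⟨U, hUc, ?_⟩
  have hne : U.Nonempty := by
    rw [← Finset.card_pos]
    have : (0 : ℝ) < U.card := lt_of_lt_of_le (mul_pos (by linarith) hfpos) hUc
    exact_mod_cast this
  refine le_trans ?_ (liminf_bound hh7 U hne (fun π hπ => (Finset.mem_filter.mp hπ).2))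
  exact Real.rpow_le_rpow_of_exponent_le (by norm_num) hhx
end

section
/- For all positive integers k and n and every k-permutation π, ex(n,π) ≤ 3k·2^{8k}·n. -/
open Filter

/-- interval minor of all-ones `r × l`, rows in `R`, columns within `[c,d]`. -/
def MinR (S : Finset (ℕ × ℕ)) (R : Finset ℕ) (c d r l : ℕ) : Prop :=
  ∃ x y : ℕ → ℕ, c ≤ y 0 ∧ y l ≤ d ∧ ∀ a < r, ∀ b < l, ∃ i ∈ R, ∃ j, (i, j) ∈ S ∧
    x a ≤ i ∧ i < x (a+1) ∧ y b ≤ j ∧ j < y (b+1)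

def MinJ (S : Finset (ℕ × ℕ)) (r l : ℕ) : Prop :=
  ∃ x y : ℕ → ℕ, ∀ a < r, ∀ b < l, ∃ i j, (i, j) ∈ S ∧
    x a ≤ i ∧ i < x (a+1) ∧ y b ≤ j ∧ j < y (b+1)

lemma exists_sep (R : Finset ℕ) (r : ℕ) (h : r ≤ R.card) :
    ∃ x : ℕ → ℕ, ∀ a < r, ∃ i ∈ R, x a ≤ i ∧ i < x (a+1) := by
  let f := R.orderEmbOfFin rfl
  refine ⟨fun a => match a with
    | 0 => 0
    | a+1 => if h : a < R.card then f ⟨a, h⟩ + 1 else 0, ?_⟩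
  intro a ha
  have ha' : a < R.card := by omega
  refine ⟨f ⟨a, ha'⟩, R.orderEmbOfFin_mem rfl _, ?_, ?_⟩
  · cases a with
    | zero => simp
    | succ b =>
      have hb : b < R.card := by omega
      simp only [hb, dite_true]
      have : f ⟨b, hb⟩ < f ⟨b+1, ha'⟩ := by
        apply f.strictMono
        simp
      omega
  · simp [ha']

def cnt (S : Finset (ℕ × ℕ)) (i c d : ℕ) : ℕ := ((Finset.Ico c d).filter fun j => (i, j) ∈ S).card

lemma cnt_split (S : Finset (ℕ × ℕ)) (i a b c : ℕ) (h1 : a ≤ b) (h2 : b ≤ c) :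
    cnt S i a c = cnt S i a b + cnt S i b c := by
  unfold cnt
  rw [← Finset.Ico_union_Ico_eq_Ico h1 h2, Finset.filter_union, Finset.card_union_of_disjoint]
  exact Finset.disjoint_filter_filter (Finset.Ico_disjoint_Ico_consecutive a b c)

lemma cnt_pos {S : Finset (ℕ × ℕ)} {i a b : ℕ} (h : 0 < cnt S i a b) :
    ∃ j, (i, j) ∈ S ∧ a ≤ j ∧ j < b := by
  unfold cnt at h
  obtain ⟨j, hj⟩ := Finset.card_pos.1 h
  simp at hj
  exact ⟨j, hj.2, hj.1.1, hj.1.2⟩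

lemma cnt_le (S : Finset (ℕ × ℕ)) (i a b : ℕ) : cnt S i a b ≤ b - a := by
  unfold cnt
  refine (Finset.card_filter_le _ _).trans ?_
  simp

lemma MinR.mono {S : Finset (ℕ × ℕ)} {R R' : Finset ℕ} {c d c' d' r l : ℕ}
    (h : MinR S R c d r l) (hR : R ⊆ R') (hc : c' ≤ c) (hd : d ≤ d') : MinR S R' c' d' r l := by
  obtain ⟨x, y, h1, h2, h3⟩ := h
  refine ⟨x, y, by omega, by omega, fun a ha b hb => ?_⟩
  obtain ⟨i, hi, j, hj⟩ := h3 a ha b hb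
  exact ⟨i, hR hi, j, hj⟩

lemma MinR.left {S : Finset (ℕ × ℕ)} {R : Finset ℕ} {c e d r l : ℕ}
    (h : MinR S R e d r (l+1)) (hR : ∀ i ∈ R, 0 < cnt S i c e) : MinR S R c d r (l+2) := by
  obtain ⟨x, y, h1, h2, h3⟩ := h
  refine ⟨x, fun b => match b with | 0 => c | b+1 => y b, by simp, by simpa using h2, ?_⟩
  intro a ha b hb
  cases b with
  | zero =>
    obtain ⟨i, hi, j, hj, hxa, hxb, -⟩ := h3 a ha 0 (by omega)
    obtain ⟨j', hj', h4, h5⟩ := cnt_pos (hR i hi)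
    exact ⟨i, hi, j', hj', hxa, hxb, h4, by simp; omega⟩
  | succ b =>
    obtain ⟨i, hi, j, hj⟩ := h3 a ha b (by omega)
    exact ⟨i, hi, j, hj⟩

lemma MinR.right {S : Finset (ℕ × ℕ)} {R : Finset ℕ} {c e d r l : ℕ}
    (h : MinR S R c e r (l+1)) (hR : ∀ i ∈ R, 0 < cnt S i e d) : MinR S R c d r (l+2) := by
  obtain ⟨x, y, h1, h2, h3⟩ := h
  refine ⟨x, fun b => if b ≤ l+1 then y b else d, by simpa using h1, by simp, ?_⟩
  intro a ha b hb
  by_cases hbl : b < l+1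
  · obtain ⟨i, hi, j, hj, hxa, hxb, h4, h5⟩ := h3 a ha b hbl
    refine ⟨i, hi, j, hj, hxa, hxb, ?_, ?_⟩
    · simp only [show b ≤ l+1 by omega, if_true]; exact h4
    · simp only [show b+1 ≤ l+1 by omega, if_true]; exact h5
  · obtain rfl : b = l+1 := by omega
    obtain ⟨i, hi, j, hj, hxa, hxb, -⟩ := h3 a ha 0 (by omega)
    obtain ⟨j', hj', h4, h5⟩ := cnt_pos (hR i hi)
    refine ⟨i, hi, j', hj', hxa, hxb, ?_, ?_⟩
    · simp only [le_refl, if_true]; omega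
    · simp only [show ¬ (l+1+1 ≤ l+1) by omega, if_false]; exact h5

lemma row_base (S : Finset (ℕ × ℕ)) (r m e c : ℕ) (R : Finset ℕ)
    (hR : ∀ i ∈ R, 2^e ≤ cnt S i c (c+2^m)) (hM : ¬ MinR S R c (c+2^m) r 1) :
    R.card * 2^e ≤ r * 4^m := by
  rcases R.eq_empty_or_nonempty with rfl | ⟨i, hi⟩
  · simp
  have h1 : 2^e ≤ 2^m := (hR i hi).trans ((cnt_le _ _ _ _).trans (by simp))
  have h2 : 2^m ≤ 4^m := Nat.pow_le_pow_left (by norm_num) m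
  have h3 : R.card ≤ r := by
    by_contra hlt
    obtain ⟨x, hx⟩ := exists_sep R r (by omega)
    apply hM
    refine ⟨x, fun b => if b = 0 then c else c + 2^m, by simp, by simp, ?_⟩
    intro a ha b hb
    obtain rfl : b = 0 := by omega
    obtain ⟨i, hi, h4, h5⟩ := hx a ha
    obtain ⟨j, hj, h6, h7⟩ := cnt_pos (lt_of_lt_of_le (by positivity) (hR i hi))
    exact ⟨i, hi, j, hj, h4, h5, by simpa using h6, by simpa using h7⟩
  exact Nat.mul_le_mul h3 (h1.trans h2)

lemma row_bound (S : Finset (ℕ × ℕ)) (r : ℕ) : ∀ (m l e c : ℕ) (R : Finset ℕ), l ≤ e →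
    (∀ i ∈ R, 2^e ≤ cnt S i c (c+2^m)) → ¬ MinR S R c (c+2^m) r (l+1) →
    R.card * 2^e ≤ 2^l * r * 4^m := by
  intro m
  induction m with
  | zero =>
    intro l e c R hle hR hM
    cases l with
    | zero => simpa using row_base S r 0 e c R hR hM
    | succ l =>
      rcases R.eq_empty_or_nonempty with rfl | ⟨i, hi⟩
      · simp
      have h1 : 2^e ≤ 2^0 := (hR i hi).trans ((cnt_le _ _ _ _).trans (by omega))
      have := (Nat.pow_le_pow_iff_right (a := 2) (by norm_num)).1 h1
      omega
  | succ m ih =>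
    intro l e c R hle hR hM
    cases l with
    | zero => simpa using row_base S r (m+1) e c R hR hM
    | succ l =>
    obtain ⟨e, rfl⟩ : ∃ e', e = e'+1 := ⟨e-1, by omega⟩
    have hd : c + 2^(m+1) = c + 2^m + 2^m := by ring
    rw [hd] at hR hM
    have hs : ∀ i, cnt S i c (c+2^m+2^m) = cnt S i c (c+2^m) + cnt S i (c+2^m) (c+2^m+2^m) :=
      fun i => cnt_split S i _ _ _ (Nat.le_add_right _ _) (Nat.le_add_right _ _)
    have hp2 : 0 < 2^m := by positivity
    have hcd : c ≤ c + 2^m := Nat.le_add_right _ _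
    have hcd2 : c + 2^m ≤ c + 2^m + 2^m := Nat.le_add_right _ _
    set d := c + 2^m with hdd
    let R1 := R.filter fun i => cnt S i d (d+2^m) = 0
    let R2 := R.filter fun i => cnt S i c d = 0
    let R3 := R.filter fun i => 0 < cnt S i d (d+2^m) ∧ 2^e ≤ cnt S i c d
    let R4 := R.filter fun i => 0 < cnt S i c d ∧ 2^e ≤ cnt S i d (d+2^m)
    have b1 := ih (l+1) (e+1) c R1 hle (by
      intro i hi
      have hi := Finset.mem_filter.1 hi
      have := hR i hi.1; have := hs i; rw [← hdd]; omega)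
      (fun h => hM (h.mono (Finset.filter_subset _ _) (by omega) (by omega)))
    have b2 := ih (l+1) (e+1) d R2 hle (by
      intro i hi
      have hi := Finset.mem_filter.1 hi
      have := hR i hi.1; have := hs i; omega)
      (fun h => hM (h.mono (Finset.filter_subset _ _) (by omega) (by omega)))
    have b3 := ih l e c R3 (by omega) (by
      intro i hi
      exact (Finset.mem_filter.1 hi).2.2)
      (fun h => hM ((MinR.right (d := d + 2^m) h
        (fun i hi => (Finset.mem_filter.1 hi).2.1)).mono
          (Finset.filter_subset _ _) (by omega) (by omega)))
    have b4 := ih l e d R4 (by omega) (by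
      intro i hi
      exact (Finset.mem_filter.1 hi).2.2)
      (fun h => hM ((MinR.left (c := c) h
        (fun i hi => (Finset.mem_filter.1 hi).2.1)).mono
          (Finset.filter_subset _ _) (by omega) (by omega)))
    have hsub : R ⊆ (R1 ∪ R2) ∪ (R3 ∪ R4) := by
      intro i hi
      have h1 := hR i hi
      have h2 := hs i
      have h3 : 2^(e+1) = 2^e + 2^e := by ring
      simp only [R1, R2, R3, R4, Finset.mem_union, Finset.mem_filter, hi, true_and]
      omega
    have hc : R.card ≤ (R1.card + R2.card) + (R3.card + R4.card) :=
      (Finset.card_le_card hsub).trans ((Finset.card_union_le _ _).trans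
        (Nat.add_le_add (Finset.card_union_le _ _) (Finset.card_union_le _ _)))
    calc R.card * 2^(e+1) ≤ ((R1.card + R2.card) + (R3.card + R4.card)) * 2^(e+1) :=
          Nat.mul_le_mul_right _ hc
      _ = R1.card * 2^(e+1) + R2.card * 2^(e+1) + 2 * (R3.card * 2^e) + 2 * (R4.card * 2^e) := by
          ring
      _ ≤ 2^(l+1)*r*4^m + 2^(l+1)*r*4^m + 2*(2^l*r*4^m) + 2*(2^l*r*4^m) := by omega
      _ = 2^(l+1)*r*4^(m+1) := by ring

/-- The number of wide blocks in a block column. -/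
lemma wide_bound (S : Finset (ℕ × ℕ)) (κ m v : ℕ) (hS : ¬ MinJ S (κ+1) (κ+1)) (R : Finset ℕ)
    (hR : ∀ u ∈ R, 2^κ ≤ cnt (S.image fun p => (p.1 / 2^m, p.2)) u (v*2^m) (v*2^m+2^m)) :
    R.card ≤ (κ+1) * 4^m := by
  have h := row_bound (S.image fun p => (p.1 / 2^m, p.2)) (κ+1) m κ κ (v*2^m) R le_rfl hR (by
    rintro ⟨x, y, -, -, h⟩
    apply hS
    refine ⟨fun a => x a * 2^m, y, fun a ha b hb => ?_⟩
    obtain ⟨i, -, j, hj, h1, h2, h3, h4⟩ := h a ha b hb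
    simp only [Finset.mem_image, Prod.mk.injEq] at hj
    obtain ⟨p, hp, rfl, rfl⟩ := hj
    refine ⟨p.1, p.2, hp, ?_, ?_, h3, h4⟩
    · exact (Nat.le_div_iff_mul_le (by positivity)).1 h1
    · exact (Nat.div_lt_iff_lt_mul (by positivity)).1 h2)
  have h2 : R.card * 2^κ ≤ ((κ+1) * 4^m) * 2^κ := by linarith
  exact Nat.le_of_mul_le_mul_right h2 (by positivity)

lemma MinJ.swap {S : Finset (ℕ × ℕ)} {r l : ℕ} (h : MinJ (S.image Prod.swap) r l) : MinJ S l r := by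
  obtain ⟨x, y, h⟩ := h
  refine ⟨y, x, fun a ha b hb => ?_⟩
  obtain ⟨i, j, hj, h1, h2, h3, h4⟩ := h b hb a ha
  simp only [Finset.mem_image] at hj
  obtain ⟨p, hp, h5⟩ := hj
  have : p = (j, i) := by rw [← Prod.swap_swap p, h5]; rfl
  exact ⟨j, i, this ▸ hp, h3, h4, h1, h2⟩

/-- The number of wide blocks. -/
lemma wide_total (S : Finset (ℕ × ℕ)) (κ m N : ℕ) (hS : ¬ MinJ S (κ+1) (κ+1))
    (W : Finset (ℕ × ℕ)) (hN : ∀ p ∈ W, p.2 < N)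
    (hW : ∀ p ∈ W, 2^κ ≤
      cnt (S.image fun p => (p.1 / 2^m, p.2)) p.1 (p.2*2^m) (p.2*2^m+2^m)) :
    W.card ≤ ((κ+1) * 4^m) * N := by
  have := Finset.card_le_mul_card_image_of_maps_to (s := W) (t := Finset.range N) (f := Prod.snd)
    (fun p hp => by simpa using hN p hp) ((κ+1) * 4^m) (by
      intro v hv
      have hinj : ((W.filter fun p => p.2 = v).image Prod.fst).card
          = (W.filter fun p => p.2 = v).card := by
        apply Finset.card_image_of_injOn
        intro p hp q hq hpq
        simp at hp hq
        exact Prod.ext hpq (hp.2.trans hq.2.symm)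
      rw [← hinj]
      apply wide_bound S κ m v hS
      intro u hu
      simp only [Finset.mem_image, Finset.mem_filter] at hu
      obtain ⟨p, ⟨hp, rfl⟩, rfl⟩ := hu
      exact hW p hp)
  simpa using this

/-- Columns met by a block. -/
lemma block_cols (S : Finset (ℕ × ℕ)) (t u v : ℕ) (ht : 0 < t) :
    ((S.filter fun p => (p.1 / t, p.2 / t) = (u, v)).image Prod.snd).card ≤
      cnt (S.image fun p => (p.1 / t, p.2)) u (v*t) (v*t+t) := by
  unfold cnt
  apply Finset.card_le_card
  intro j hj
  simp only [Finset.mem_image, Finset.mem_filter, Prod.mk.injEq, Finset.mem_Ico] at hj ⊢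
  obtain ⟨p, ⟨hp, h1, h2⟩, rfl⟩ := hj
  refine ⟨⟨?_, ?_⟩, p, hp, h1, rfl⟩
  · exact (Nat.le_div_iff_mul_le ht).1 h2.ge
  · have := (Nat.div_lt_iff_lt_mul ht).1 (show p.2 / t < v+1 by omega)
    linarith

lemma card_le_proj (F : Finset (ℕ × ℕ)) :
    F.card ≤ (F.image Prod.fst).card * (F.image Prod.snd).card := by
  rw [← Finset.card_product]
  apply Finset.card_le_card
  intro p hp
  simp only [Finset.mem_product]
  exact ⟨Finset.mem_image_of_mem _ hp, Finset.mem_image_of_mem _ hp⟩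

lemma block_rows (S : Finset (ℕ × ℕ)) (t u v : ℕ) (ht : 0 < t) :
    ((S.filter fun p => (p.1 / t, p.2 / t) = (u, v)).image Prod.fst).card ≤
      cnt ((S.image Prod.swap).image fun p => (p.1 / t, p.2)) v (u*t) (u*t+t) := by
  refine le_trans (Finset.card_le_card ?_) (block_cols (S.image Prod.swap) t v u ht)
  intro j hj
  simp only [Finset.mem_image, Finset.mem_filter, Prod.mk.injEq] at hj ⊢
  obtain ⟨p, ⟨hp, h1, h2⟩, rfl⟩ := hj
  exact ⟨p.swap, ⟨⟨p, hp, rfl⟩, h2, h1⟩, rfl⟩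

lemma step (S : Finset (ℕ × ℕ)) (κ m N : ℕ) (hS : ¬ MinJ S (κ+1) (κ+1))
    (hN : ∀ p ∈ S.image (fun p => (p.1 / 2^m, p.2 / 2^m)), p.1 < N ∧ p.2 < N) :
    S.card ≤ (2^κ*2^κ) * (S.image (fun p => (p.1 / 2^m, p.2 / 2^m))).card
      + (2^m*2^m) * (2 * (((κ+1) * 4^m) * N)) := by
  have ht : 0 < 2^m := by positivity
  set t := 2^m with htt
  set B := S.image (fun p => (p.1 / t, p.2 / t)) with hB
  let cc : ℕ × ℕ → ℕ := fun p => cnt (S.image fun p => (p.1 / t, p.2)) p.1 (p.2*t) (p.2*t+t)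
  let rr : ℕ × ℕ → ℕ :=
    fun p => cnt ((S.image Prod.swap).image fun p => (p.1 / t, p.2)) p.2 (p.1*t) (p.1*t+t)
  let W := B.filter fun p => 2^κ ≤ cc p
  let T := B.filter fun p => 2^κ ≤ rr p
  have hW : W.card ≤ ((κ+1) * 4^m) * N :=
    wide_total S κ m N hS W (fun p hp => (hN p (Finset.mem_filter.1 hp).1).2)
      (fun p hp => (Finset.mem_filter.1 hp).2)
  have hT : T.card ≤ ((κ+1) * 4^m) * N := by
    have := wide_total (S.image Prod.swap) κ m N (fun h => hS h.swap) (T.image Prod.swap)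
      (by
        intro p hp
        obtain ⟨q, hq, rfl⟩ := Finset.mem_image.1 hp
        exact (hN q (Finset.mem_filter.1 hq).1).1)
      (by
        intro p hp
        obtain ⟨q, hq, rfl⟩ := Finset.mem_image.1 hp
        exact (Finset.mem_filter.1 hq).2)
    rwa [Finset.card_image_of_injective _ Prod.swap_injective] at this
  have hcard : S.card = ∑ b ∈ B, (S.filter fun p => (p.1 / t, p.2 / t) = b).card :=
    Finset.card_eq_sum_card_fiberwise (fun p hp => by
      simpa [hB] using Finset.mem_image_of_mem (fun p : ℕ × ℕ => (p.1 / t, p.2 / t)) hp)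
  have hfib : ∀ b ∈ B, (S.filter fun p => (p.1 / t, p.2 / t) = b).card ≤
      2^κ*2^κ + ((if 2^κ ≤ cc b then t*t else 0) + (if 2^κ ≤ rr b then t*t else 0)) := by
    rintro ⟨u, v⟩ -
    have h1 := card_le_proj (S.filter fun p => (p.1 / t, p.2 / t) = (u, v))
    have h2 : _ ≤ cc (u, v) := block_cols S t u v ht
    have h3 : _ ≤ rr (u, v) := block_rows S t u v ht
    have h4 : cc (u, v) ≤ t := (cnt_le _ _ _ _).trans (by omega)
    have h5 : rr (u, v) ≤ t := (cnt_le _ _ _ _).trans (by omega)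
    have h6 := h1.trans (Nat.mul_le_mul h3 h2)
    have h7 := Nat.mul_le_mul h5 h4
    split_ifs with ha hb hb
    · omega
    · omega
    · omega
    · have := Nat.mul_le_mul (not_le.1 hb).le (not_le.1 ha).le
      omega
  rw [hcard]
  refine (Finset.sum_le_sum hfib).trans ?_
  rw [Finset.sum_add_distrib, Finset.sum_add_distrib, Finset.sum_const, ← Finset.sum_filter,
    ← Finset.sum_filter, Finset.sum_const, Finset.sum_const]
  change B.card • _ + (W.card • _ + T.card • _) ≤ _
  simp only [smul_eq_mul]
  nlinarith [Nat.mul_le_mul_left (t*t) hW, Nat.mul_le_mul_left (t*t) hT]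

lemma main_bound (κ : ℕ) : ∀ n (S : Finset (ℕ × ℕ)), (∀ p ∈ S, p.1 < n ∧ p.2 < n) →
    ¬ MinJ S (κ+1) (κ+1) → S.card ≤ 8 * (κ+1) * (2^(2*κ+2))^3 * n := by
  intro n
  induction n using Nat.strong_induction_on with
  | _ n ih =>
  intro S hn hS
  have ht4 : 4 ≤ 2^(2*κ+2) := by
    have : 0 < 2^(2*κ) := by positivity
    rw [pow_add]; omega
  have hst : 4 * (2^κ*2^κ) = 2^(2*κ+2) := by ring
  have h4m : 4^(2*κ+2) = 2^(2*κ+2) * 2^(2*κ+2) := by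
    rw [← mul_pow]; norm_num
  rcases lt_or_ge n (2^(2*κ+2)) with hlt | hge
  · have h1 : S.card ≤ n * n := by
      have : S ⊆ Finset.range n ×ˢ Finset.range n := fun p hp => by simpa using hn p hp
      simpa using Finset.card_le_card this
    refine h1.trans (Nat.mul_le_mul_right _ ?_)
    generalize 2^(2*κ+2) = t at *
    have h2 : t ≤ t^3 := Nat.le_self_pow (by norm_num) t
    nlinarith [Nat.zero_le (κ * t^3)]
  · set N := n / 2^(2*κ+2) + 1 with hNdef
    have hNt : N * 2^(2*κ+2) ≤ 2 * n := by
      have := Nat.div_mul_le_self n (2^(2*κ+2))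
      rw [hNdef, add_mul]; omega
    have hNn : N < n := by nlinarith
    have hB : ∀ p ∈ S.image (fun p => (p.1 / 2^(2*κ+2), p.2 / 2^(2*κ+2))), p.1 < N ∧ p.2 < N := by
      intro p hp
      obtain ⟨q, hq, rfl⟩ := Finset.mem_image.1 hp
      have := hn q hq
      exact ⟨Nat.lt_succ_of_le (Nat.div_le_div_right this.1.le),
        Nat.lt_succ_of_le (Nat.div_le_div_right this.2.le)⟩
    have h1 := step S κ (2*κ+2) N hS hB
    have h2 := ih N hNn _ hB (by
      rintro ⟨x, y, h⟩
      apply hS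
      refine ⟨fun a => x a * 2^(2*κ+2), fun b => y b * 2^(2*κ+2), fun a ha b hb => ?_⟩
      obtain ⟨i, j, hj, h1, h2, h3, h4⟩ := h a ha b hb
      simp only [Finset.mem_image, Prod.mk.injEq] at hj
      obtain ⟨p, hp, rfl, rfl⟩ := hj
      exact ⟨p.1, p.2, hp, (Nat.le_div_iff_mul_le (by positivity)).1 h1,
        (Nat.div_lt_iff_lt_mul (by positivity)).1 h2,
        (Nat.le_div_iff_mul_le (by positivity)).1 h3,
        (Nat.div_lt_iff_lt_mul (by positivity)).1 h4⟩)
    rw [h4m] at h1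
    generalize (S.image (fun p => (p.1 / 2^(2*κ+2), p.2 / 2^(2*κ+2)))).card = b at *
    generalize 2^(2*κ+2) = t at *
    generalize 2^κ*2^κ = s at *
    subst hst
    have h3 := Nat.mul_le_mul_left s h2
    have h5 := Nat.mul_le_mul_left (2 * (κ+1) * (4*s)^3) hNt
    have h6 := Nat.mul_le_mul_left (2 * (κ+1) * (4*s)^3) hNt
    have e1 : s * (8 * (κ+1) * (4*s)^3 * N) = 2 * (κ+1) * (4*s)^3 * (N * (4*s)) := by ring
    have e2 : (4*s)*(4*s) * (2 * ((κ+1) * ((4*s)*(4*s)) * N))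
      = 2 * (κ+1) * (4*s)^3 * (N * (4*s)) := by ring
    have e3 : 8 * (κ+1) * (4*s)^3 * n
      = 2 * (κ+1) * (4*s)^3 * (2*n) + 2 * (κ+1) * (4*s)^3 * (2*n) := by ring
    rw [e1] at h3
    rw [e2] at h1
    rw [e3]
    omega

lemma contains_of_minJ {k n : ℕ} (A : Fin n → Fin n → Bool) (π : Equiv.Perm (Fin k))
    (h : MinJ ((Finset.univ.filter fun p : Fin n × Fin n => A p.1 p.2 = true).image
      fun p => ((p.1 : ℕ), (p.2 : ℕ))) k k) : ContainsMat (permMatrix π) A := by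
  obtain ⟨x, y, h⟩ := h
  have H : ∀ a b : Fin k, ∃ i j : Fin n, A i j = true ∧
      x a ≤ i ∧ i < x (a+1) ∧ y b ≤ j ∧ j < y (b+1) := by
    intro a b
    obtain ⟨i, j, hj, h1⟩ := h a a.2 b b.2
    simp only [Finset.mem_image, Finset.mem_filter, Prod.mk.injEq] at hj
    obtain ⟨p, hp, rfl, rfl⟩ := hj
    exact ⟨p.1, p.2, hp.2, h1⟩
  have mx : ∀ a b : ℕ, a ≤ b → b < k → x a ≤ x b := by
    intro a b hab
    induction b, hab using Nat.le_induction with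
    | base => intro _; exact le_rfl
    | succ b hab ih =>
      intro hb
      obtain ⟨i, j, hj⟩ := H ⟨b, by omega⟩ ⟨b, by omega⟩
      have := ih (by omega)
      simp at hj
      omega
  have my : ∀ a b : ℕ, a ≤ b → b < k → y a ≤ y b := by
    intro a b hab
    induction b, hab using Nat.le_induction with
    | base => intro _; exact le_rfl
    | succ b hab ih =>
      intro hb
      obtain ⟨i, j, hj⟩ := H ⟨b, by omega⟩ ⟨b, by omega⟩
      have := ih (by omega)
      simp at hj
      omega
  choose r c hA h1 h2 h3 h4 using H
  refine ⟨fun a => r a (π a), fun b => c (π.symm b) b, ?_, ?_, ?_⟩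
  · intro a b hab
    have e1 := h2 a (π a)
    have e2 := h1 b (π b)
    have e3 := mx (a+1) b hab b.2
    show (r a (π a) : ℕ) < r b (π b)
    omega
  · intro a b hab
    have e1 := h4 (π.symm a) a
    have e2 := h3 (π.symm b) b
    have e3 := my (a+1) b hab b.2
    show (c (π.symm a) a : ℕ) < c (π.symm b) b
    omega
  · intro i j hij
    have : π i = j := by simpa [permMatrix] using hij
    subst this
    simpa using hA i (π i)

/-- For all positive integers `k` and `n` and every
`k`-permutation `π`, `ex(n,π) ≤ 3k·2^{8k}·n`. -/
theorem stmt2 (k n : ℕ) (hk : 0 < k) (hn : 0 < n) (π : Equiv.Perm (Fin k)) :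
    exP n π ≤ 3 * k * 2 ^ (8 * k) * n := by
  obtain ⟨κ, rfl⟩ : ∃ κ, k = κ + 1 := ⟨k-1, by omega⟩
  have key : ∀ A : Fin n → Fin n → Bool, AvoidsPerm A π →
      mass A ≤ 3 * (κ+1) * 2 ^ (8 * (κ+1)) * n := by
    intro A hA
    have h := main_bound κ n ((Finset.univ.filter fun p : Fin n × Fin n => A p.1 p.2 = true).image
      fun p => ((p.1 : ℕ), (p.2 : ℕ))) (by
        intro p hp
        obtain ⟨q, hq, rfl⟩ := Finset.mem_image.1 hp
        exact ⟨q.1.2, q.2.2⟩) (fun h => hA (contains_of_minJ A π h))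
    rw [Finset.card_image_of_injective _ (by
      intro p q hpq
      simp only [Prod.mk.injEq] at hpq
      exact Prod.ext (Fin.ext hpq.1) (Fin.ext hpq.2))] at h
    refine h.trans (Nat.mul_le_mul_right _ ?_)
    have e1 : (2^(2*κ+2))^3 = 2^(6*κ) * 64 := by rw [← pow_mul, show 64 = 2^6 by norm_num, ← pow_add]; congr 1; ring
    have e2 : 2^(8*(κ+1)) = 2^(6*κ) * 2^(2*κ) * 256 := by
      rw [show 256 = 2^8 by norm_num, ← pow_add, ← pow_add]; congr 1; ring
    rw [e1, e2]
    clear e1 e2 h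
    have h3 : 2^(6*κ) * 1 ≤ 2^(6*κ) * 2^(2*κ) := Nat.mul_le_mul_left _ Nat.one_le_two_pow
    have h4 := Nat.mul_le_mul_left (κ+1) h3
    generalize 2^(6*κ) * 2^(2*κ) = X at *
    generalize 2^(6*κ) = Y at *
    calc 8 * (κ+1) * (Y * 64) = 512 * ((κ+1) * (Y * 1)) := by ring
      _ ≤ 512 * ((κ+1) * X) := by omega
      _ ≤ 768 * ((κ+1) * X) := by omega
      _ = 3 * (κ+1) * (X * 256) := by ring
  unfold exP
  rcases Set.eq_empty_or_nonempty {m | ∃ A : Fin n → Fin n → Bool, AvoidsPerm A π ∧ mass A = m} with h | h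
  · rw [h]; simp
  · apply csSup_le h
    rintro m ⟨A, hA, rfl⟩
    exact key A hA
end

section
/- For all integers ℓ ≥ 2 and k ≥ 3ℓ²·ln ℓ, the number of k-permutations whose permutation matrix avoids J_ℓ as an interval minor is at most k!/ℓ. -/
open Filter

lemma aux_intervals {k l : ℕ} (f : Fin k → Fin l) (hf : Monotone f) (hs : Function.Surjective f) :
    ∃ lo hi : Fin l → Fin k, (∀ a, lo a ≤ hi a) ∧ (∀ a b, a < b → hi a < lo b) ∧
      ∀ i, lo (f i) ≤ i ∧ i ≤ hi (f i) := by
  classical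
  have hne : ∀ a, (Finset.univ.filter fun i => f i = a).Nonempty := fun a => by
    obtain ⟨i, hi⟩ := hs a
    exact ⟨i, by simp [hi]⟩
  have hlo : ∀ a, f ((Finset.univ.filter fun i => f i = a).min' (hne a)) = a := fun a => by
    simpa using Finset.min'_mem _ (hne a)
  have hhi : ∀ a, f ((Finset.univ.filter fun i => f i = a).max' (hne a)) = a := fun a => by
    simpa using Finset.max'_mem _ (hne a)
  refine ⟨fun a => (Finset.univ.filter fun i => f i = a).min' (hne a),
    fun a => (Finset.univ.filter fun i => f i = a).max' (hne a), ?_, ?_, ?_⟩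
  · intro a
    exact Finset.min'_le_max' _ _
  · intro a b hab
    by_contra h
    have h2 := hf (not_lt.mp h)
    rw [hlo, hhi] at h2
    exact absurd hab (not_lt.mpr h2)
  · intro i
    exact ⟨Finset.min'_le _ _ (by simp), Finset.le_max' _ _ (by simp)⟩

lemma aux_minor {k l : ℕ} (π : Equiv.Perm (Fin k)) (f g : Fin k → Fin l) (hf : Monotone f)
    (hg : Monotone g) (h : ∀ a b, ∃ i, f i = a ∧ g (π i) = b) :
    IntervalMinor (J l l) (permMatrix π) := by
  obtain ⟨rlo, rhi, h1, h2, h3⟩ := aux_intervals f hf (fun a => by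
    obtain ⟨i, hi, _⟩ := h a a
    exact ⟨i, hi⟩)
  obtain ⟨clo, chi, h4, h5, h6⟩ := aux_intervals g hg (fun a => by
    obtain ⟨i, _, hi⟩ := h a a
    exact ⟨π i, hi⟩)
  refine ⟨rlo, rhi, clo, chi, h1, h2, h4, h5, ?_⟩
  intro a b _
  obtain ⟨i, rfl, rfl⟩ := h a b
  exact ⟨i, π i, (h3 i).1, (h3 i).2, (h6 _).1, (h6 _).2, by simp [permMatrix]⟩

open Classical in
lemma aux_fg {k l : ℕ} (f g : Fin k → Fin l) :
    (Finset.univ.filter fun π : Equiv.Perm (Fin k) =>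
        ¬ IntervalMinor (J l l) (permMatrix π)).card ≤
      (Finset.univ.filter fun ρ : Equiv.Perm (Fin k) =>
        ∃ p : Fin l × Fin l, ∀ j, (f j, g (ρ j)) ≠ p).card := by
  apply Finset.card_le_card_of_injOn (fun π => Tuple.sort g * π * (Tuple.sort f)⁻¹)
  · intro π hπ
    simp only [Finset.coe_filter, Finset.mem_univ, true_and, Set.mem_ofPred_eq] at hπ ⊢
    by_contra hcon
    push Not at hcon
    apply hπ
    refine aux_minor π (f ∘ Tuple.sort f) (g ∘ Tuple.sort g) (Tuple.monotone_sort f)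
      (Tuple.monotone_sort g) ?_
    intro a b
    obtain ⟨j, hj⟩ := hcon (a, b)
    refine ⟨(Tuple.sort f)⁻¹ j, ?_, ?_⟩
    · simpa using congrArg Prod.fst hj
    · simpa using congrArg Prod.snd hj
  · intro π _ π' _ h
    simpa using h

open Classical in
lemma aux_rho {k l : ℕ} (ρ : Equiv.Perm (Fin k)) :
    (Finset.univ.filter fun q : (Fin k → Fin l) × (Fin k → Fin l) =>
        ∃ p : Fin l × Fin l, ∀ j, (q.1 j, q.2 (ρ j)) ≠ p).card ≤ l ^ 2 * (l ^ 2 - 1) ^ k := by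
  calc _ ≤ ((Finset.univ : Finset (Fin l × Fin l)).biUnion fun p =>
          Fintype.piFinset fun _ : Fin k => Finset.univ.erase p).card := by
        apply Finset.card_le_card_of_injOn (fun q j => (q.1 j, q.2 (ρ j)))
        · intro q hq
          simpa using hq
        · intro q _ q' _ h
          have h' := fun j => congrFun h j
          simp only [Prod.mk.injEq] at h'
          refine Prod.ext (funext fun j => (h' j).1) (funext fun j => ?_)
          simpa using (h' (ρ.symm j)).2
    _ ≤ ∑ p : Fin l × Fin l, (Fintype.piFinset fun _ : Fin k => Finset.univ.erase p).card :=
        Finset.card_biUnion_le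
    _ = _ := by
        simp [Fintype.card_piFinset, Finset.card_erase_of_mem, sq]

open Classical in
lemma aux_count {k l : ℕ} :
    (l ^ 2) ^ k * (Finset.univ.filter fun π : Equiv.Perm (Fin k) =>
        ¬ IntervalMinor (J l l) (permMatrix π)).card ≤
      k.factorial * (l ^ 2 * (l ^ 2 - 1) ^ k) := by
  set B := (Finset.univ.filter fun π : Equiv.Perm (Fin k) =>
        ¬ IntervalMinor (J l l) (permMatrix π)).card
  calc (l ^ 2) ^ k * B = ∑ q : (Fin k → Fin l) × (Fin k → Fin l), B := by
        simp [sq, mul_pow]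
    _ ≤ ∑ q : (Fin k → Fin l) × (Fin k → Fin l),
        (Finset.univ.filter fun ρ : Equiv.Perm (Fin k) =>
          ∃ p : Fin l × Fin l, ∀ j, (q.1 j, q.2 (ρ j)) ≠ p).card :=
        Finset.sum_le_sum fun q _ => aux_fg q.1 q.2
    _ = ∑ ρ : Equiv.Perm (Fin k),
        (Finset.univ.filter fun q : (Fin k → Fin l) × (Fin k → Fin l) =>
          ∃ p : Fin l × Fin l, ∀ j, (q.1 j, q.2 (ρ j)) ≠ p).card := by
        simp only [Finset.card_filter]
        exact Finset.sum_comm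
    _ ≤ ∑ ρ : Equiv.Perm (Fin k), l ^ 2 * (l ^ 2 - 1) ^ k :=
        Finset.sum_le_sum fun ρ _ => aux_rho ρ
    _ = _ := by simp [Fintype.card_perm]

/-- For all integers `ℓ ≥ 2` and `k ≥ 3ℓ²·ln ℓ`, the number of
`k`-permutations whose permutation matrix avoids `J_ℓ` as an interval minor is
at most `k!/ℓ`. -/
theorem stmt5 (ℓ k : ℕ) (hl : 2 ≤ ℓ) (hk : 3 * (ℓ : ℝ) ^ 2 * Real.log (ℓ : ℝ) ≤ (k : ℝ)) :
    (Nat.card {π : Equiv.Perm (Fin k) // ¬ IntervalMinor (J ℓ ℓ) (permMatrix π)} : ℝ) ≤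
      (Nat.factorial k : ℝ) / (ℓ : ℝ) := by
  classical
  rw [Nat.card_eq_fintype_card, Fintype.card_subtype]
  have hc := aux_count (k := k) (l := ℓ)
  set B := (Finset.univ.filter fun π : Equiv.Perm (Fin k) =>
        ¬ IntervalMinor (J ℓ ℓ) (permMatrix π)).card
  have hl0 : (0 : ℝ) < ℓ := by exact_mod_cast (by omega : 0 < ℓ)
  have h1 : 1 ≤ ℓ ^ 2 := Nat.one_le_pow _ _ (by omega)
  have hc' : ((ℓ : ℝ) ^ 2) ^ k * B ≤ k.factorial * ((ℓ : ℝ) ^ 2 * ((ℓ : ℝ) ^ 2 - 1) ^ k) := by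
    have : (((ℓ ^ 2) ^ k * B : ℕ) : ℝ) ≤ ((k.factorial * (ℓ ^ 2 * (ℓ ^ 2 - 1) ^ k) : ℕ) : ℝ) := by
      exact_mod_cast hc
    push_cast [Nat.cast_sub h1] at this
    exact this
  have hL : (0 : ℝ) < (ℓ : ℝ) ^ 2 := by positivity
  have h1' : (1 : ℝ) ≤ (ℓ : ℝ) ^ 2 := by exact_mod_cast h1
  have hb : ((ℓ : ℝ) ^ 2 - 1) ≤ (ℓ : ℝ) ^ 2 * Real.exp (-(1 / (ℓ : ℝ) ^ 2)) := by
    have := Real.add_one_le_exp (-(1 / (ℓ : ℝ) ^ 2))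
    calc ((ℓ : ℝ) ^ 2 - 1) = (ℓ : ℝ) ^ 2 * (-(1 / (ℓ : ℝ) ^ 2) + 1) := by field_simp; ring
      _ ≤ _ := mul_le_mul_of_nonneg_left this hL.le
  have he : Real.exp (-(1 / (ℓ : ℝ) ^ 2)) ^ k ≤ 1 / (ℓ : ℝ) ^ 3 := by
    rw [← Real.exp_nat_mul]
    have h3 : 1 / (ℓ : ℝ) ^ 3 = Real.exp (-(3 * Real.log ℓ)) := by
      rw [Real.exp_neg, show (3 : ℝ) * Real.log ℓ = ((3 : ℕ) : ℝ) * Real.log ℓ by norm_num,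
        Real.exp_nat_mul, Real.exp_log hl0, one_div]
    rw [h3]
    apply Real.exp_le_exp.mpr
    have : 3 * Real.log ℓ ≤ k / (ℓ : ℝ) ^ 2 := by
      rw [le_div_iff₀ hL]
      linarith
    have h4 : (k : ℝ) * -(1 / (ℓ : ℝ) ^ 2) = -(k / (ℓ : ℝ) ^ 2) := by ring
    rw [h4]
    linarith
  have hp : ((ℓ : ℝ) ^ 2 - 1) ^ k ≤ ((ℓ : ℝ) ^ 2) ^ k * (1 / (ℓ : ℝ) ^ 3) := by
    calc _ ≤ ((ℓ : ℝ) ^ 2 * Real.exp (-(1 / (ℓ : ℝ) ^ 2))) ^ k :=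
          pow_le_pow_left₀ (by linarith) hb k
      _ = ((ℓ : ℝ) ^ 2) ^ k * Real.exp (-(1 / (ℓ : ℝ) ^ 2)) ^ k := mul_pow _ _ _
      _ ≤ _ := mul_le_mul_of_nonneg_left he (by positivity)
  have hfin : ((ℓ : ℝ) ^ 2) ^ k * B ≤ ((ℓ : ℝ) ^ 2) ^ k * (k.factorial / ℓ) := by
    calc _ ≤ _ := hc'
      _ ≤ k.factorial * ((ℓ : ℝ) ^ 2 * (((ℓ : ℝ) ^ 2) ^ k * (1 / (ℓ : ℝ) ^ 3))) := by gcongr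
      _ = ((ℓ : ℝ) ^ 2) ^ k * (k.factorial * ((ℓ : ℝ) ^ 2 * (1 / (ℓ : ℝ) ^ 3))) := by ring
      _ = _ := by
        congr 1
        field_simp
  exact le_of_mul_le_mul_left hfin (by positivity)
end

section
/- There is an absolute constant c > 0 such that for every integer k > 2 there exist a k-permutation π, a positive integer N with N ≥ 2^{c·k^{1/4}}, and an N×N binary matrix M whose mass is at least N^{3/2} and which avoids π. -/
open Filter

lemma count_avoid {α : Type*} [Fintype α] [DecidableEq α] (m : ℕ) [NeZero m] (S : Finset α) :
    ((Finset.univ.filter fun f : α → Fin m => ∀ a ∈ S, f a ≠ 0).card : ℝ)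
      = (1 - 1 / (m : ℝ)) ^ S.card * (m : ℝ) ^ Fintype.card α := by
  have hm : (m : ℝ) ≠ 0 := Nat.cast_ne_zero.mpr (NeZero.ne m)
  have h1 : (Finset.univ.filter fun f : α → Fin m => ∀ a ∈ S, f a ≠ 0)
      = Fintype.piFinset (fun a => if a ∈ S then ({0}ᶜ : Finset (Fin m)) else Finset.univ) := by
    ext f
    simp only [Finset.mem_filter, Finset.mem_univ, true_and, Fintype.mem_piFinset]
    refine forall_congr' fun a => ?_
    by_cases h : a ∈ S <;> simp [h]
  rw [h1, Fintype.card_piFinset]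
  push_cast
  have h2 : ∀ a : α, (((if a ∈ S then ({0}ᶜ : Finset (Fin m)) else Finset.univ).card : ℕ) : ℝ)
      = (if a ∈ S then (1 - 1 / (m : ℝ)) else 1) * m := by
    intro a
    by_cases h : a ∈ S
    · simp only [h, if_true]
      rw [Finset.card_compl, Finset.card_singleton, Fintype.card_fin,
        Nat.cast_sub (Nat.one_le_iff_ne_zero.mpr (NeZero.ne m))]
      field_simp
      simp
    · simp [h]
  rw [Finset.prod_congr rfl (fun a _ => h2 a), Finset.prod_mul_distrib]
  simp [Finset.prod_ite_mem]

lemma prob_exists {α ι β : Type*} [Fintype α] [DecidableEq α] [Fintype ι] [Fintype β]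
    (m : ℕ) [NeZero m] (S : ι → Finset α) (B : β → Finset α) (d e : ℕ)
    (hS : ∀ i, (S i).card ≤ d) (hB : ∀ b, (B b).card = e) (X : ℝ) (hX : 0 < X)
    (h : X + Fintype.card ι * (Fintype.card β * (1 - 1 / (m : ℝ)) ^ e)
      ≤ Fintype.card ι * (1 - 1 / (m : ℝ)) ^ d) :
    ∃ f : α → Fin m, (∀ b, ∃ a ∈ B b, f a = 0) ∧
      X ≤ ((Finset.univ.filter fun i => ∀ a ∈ S i, f a ≠ 0).card : ℝ) := by
  classical
  by_contra! hcon
  have hm : (0 : ℝ) < m := Nat.cast_pos.mpr (Nat.pos_of_ne_zero (NeZero.ne m))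
  have hm1 : (1 : ℝ) ≤ m := by exact_mod_cast (Nat.pos_of_ne_zero (NeZero.ne m))
  set q : ℝ := 1 - 1 / (m : ℝ) with hq
  have hq0 : 0 ≤ q := by
    rw [hq, sub_nonneg, div_le_one hm]; exact hm1
  have hq1 : q ≤ 1 := by
    rw [hq]; have : 0 ≤ 1 / (m : ℝ) := by positivity
    linarith
  have key : ∀ f : α → Fin m, ((Finset.univ.filter fun i => ∀ a ∈ S i, f a ≠ 0).card : ℝ)
      < X + Fintype.card ι * ((Finset.univ.filter fun b => ∀ a ∈ B b, f a ≠ 0).card : ℝ) := by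
    intro f
    by_cases hf : ∀ b, ∃ a ∈ B b, f a = 0
    · have := hcon f hf
      have h2 : (0 : ℝ) ≤ Fintype.card ι * ((Finset.univ.filter fun b => ∀ a ∈ B b, f a ≠ 0).card : ℝ) := by
        positivity
      linarith
    · push Not at hf
      obtain ⟨b, hb⟩ := hf
      have h1 : (1 : ℝ) ≤ ((Finset.univ.filter fun b => ∀ a ∈ B b, f a ≠ 0).card : ℝ) := by
        have : 0 < (Finset.univ.filter fun b => ∀ a ∈ B b, f a ≠ 0).card :=
          Finset.card_pos.mpr ⟨b, by simpa using hb⟩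
        exact_mod_cast this
      have h2 : ((Finset.univ.filter fun i => ∀ a ∈ S i, f a ≠ 0).card : ℝ) ≤ Fintype.card ι := by
        exact_mod_cast Finset.card_le_univ _
      have h3 : (0 : ℝ) ≤ Fintype.card ι := by positivity
      nlinarith
  have hne : (Finset.univ : Finset (α → Fin m)).Nonempty := Finset.univ_nonempty
  have hsum := Finset.sum_lt_sum_of_nonempty hne (fun f _ => key f)
  rw [Finset.sum_add_distrib, ← Finset.mul_sum] at hsum
  have swap : ∀ {γ : Type _} [Fintype γ] (Q : γ → Finset α),
      ∑ f : α → Fin m, ((Finset.univ.filter fun i => ∀ a ∈ Q i, f a ≠ 0).card : ℝ)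
      = ∑ i : γ, q ^ (Q i).card * (m : ℝ) ^ Fintype.card α := by
    intro γ _ Q
    rw [← Finset.sum_congr rfl (fun i _ => count_avoid m (Q i))]
    simp only [Finset.card_filter, Nat.cast_sum]
    rw [Finset.sum_comm]
  have hswapB : ∑ f : α → Fin m, ((Finset.univ.filter fun i => ∀ a ∈ B i, f a ≠ 0).card : ℝ)
      = ∑ i : β, q ^ (B i).card * (m : ℝ) ^ Fintype.card α := by
    rw [← Finset.sum_congr rfl (fun i _ => count_avoid m (B i))]
    simp only [Finset.card_filter, Nat.cast_sum]
    rw [Finset.sum_comm]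
  rw [swap S, hswapB] at hsum
  simp only [hB, Finset.sum_const, Finset.card_univ, Fintype.card_fun, Fintype.card_fin,
    nsmul_eq_mul, Nat.cast_pow] at hsum
  have hT : (0 : ℝ) < (m : ℝ) ^ Fintype.card α := by positivity
  have hlow : (Fintype.card ι : ℝ) * (q ^ d * (m : ℝ) ^ Fintype.card α)
      ≤ ∑ i : ι, q ^ (S i).card * (m : ℝ) ^ Fintype.card α := by
    have : (Fintype.card ι : ℝ) * (q ^ d * (m : ℝ) ^ Fintype.card α)
      = ∑ i : ι, q ^ d * (m : ℝ) ^ Fintype.card α := by simp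
    rw [this]
    refine Finset.sum_le_sum fun i _ => ?_
    exact mul_le_mul_of_nonneg_right (pow_le_pow_of_le_one hq0 hq1 (hS i)) hT.le
  have := mul_le_mul_of_nonneg_right h hT.le
  nlinarith

/-- dyadic node of level `t` above `i` -/
def node {r : ℕ} (t : Fin (r + 1)) (i : Fin (2 ^ r)) : Fin (r + 1) × Fin (2 ^ r) :=
  (t, ⟨i.1 / 2 ^ t.1, lt_of_le_of_lt (Nat.div_le_self _ _) i.2⟩)

lemma exists_lca {r : ℕ} (a b : Fin (2 ^ r)) :
    ∃ t : Fin (r + 1), a.1 / 2 ^ t.1 = b.1 / 2 ^ t.1 ∧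
      ∀ s < t.1, a.1 / 2 ^ s ≠ b.1 / 2 ^ s := by
  classical
  have hex : ∃ t : ℕ, a.1 / 2 ^ t = b.1 / 2 ^ t :=
    ⟨r, by rw [Nat.div_eq_of_lt a.2, Nat.div_eq_of_lt b.2]⟩
  have hr : Nat.find hex ≤ r :=
    Nat.find_min' hex (by rw [Nat.div_eq_of_lt a.2, Nat.div_eq_of_lt b.2])
  exact ⟨⟨Nat.find hex, by omega⟩, Nat.find_spec hex, fun s hs => Nat.find_min hex hs⟩

lemma lca_family {r l : ℕ} (lo hi : Fin l → Fin (2 ^ r)) (h1 : ∀ a, lo a ≤ hi a)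
    (h2 : ∀ a b, a < b → hi a < lo b) :
    ∃ R : Fin l ↪ Fin (r + 1) × Fin (2 ^ r), ∀ a, ∃ t, ∀ i, lo a ≤ i → i ≤ hi a →
      R a = node t i := by
  choose t ht ht' using fun a => exists_lca (lo a) (hi a)
  have main : ∀ a b, a < b → node (t a) (lo a) ≠ node (t b) (lo b) := by
    intro a b hab heq
    have hlt := h2 a b hab
    have h1a := h1 a
    have h1b := h1 b
    have e1 : t a = t b := congrArg Prod.fst heq
    have e2 : (lo a).1 / 2 ^ (t a).1 = (lo b).1 / 2 ^ (t b).1 :=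
      congrArg (fun x => x.2.1) heq
    have q1 := ht a
    have q2 := ht b
    have q1' := ht' a
    have q2' := ht' b
    rw [← e1] at e2 q2 q2'
    rcases hs : (t a).1 with _ | s
    · rw [hs] at e2 q1 q2
      simp only [pow_zero, Nat.div_one] at e2 q1 q2
      simp only [Fin.lt_def, Fin.le_def] at *
      omega
    · have m1 := q1' s (by omega)
      have m2 := q2' s (by omega)
      rw [hs, pow_succ, ← Nat.div_div_eq_div_mul, ← Nat.div_div_eq_div_mul] at e2 q1 q2
      have g1 : (lo a).1 / 2 ^ s ≤ (hi a).1 / 2 ^ s := Nat.div_le_div_right h1a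
      have g2 : (hi a).1 / 2 ^ s ≤ (lo b).1 / 2 ^ s := Nat.div_le_div_right hlt.le
      have g3 : (lo b).1 / 2 ^ s ≤ (hi b).1 / 2 ^ s := Nat.div_le_div_right h1b
      omega
  refine ⟨⟨fun a => node (t a) (lo a), ?_⟩, ?_⟩
  · intro a b hab
    rcases lt_trichotomy a b with h | h | h
    · exact absurd hab (main a b h)
    · exact h
    · exact absurd hab.symm (main b a h)
  · intro a
    refine ⟨t a, fun i hi1 hi2 => ?_⟩
    have g1 : (lo a).1 / 2 ^ (t a).1 ≤ i.1 / 2 ^ (t a).1 := Nat.div_le_div_right hi1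
    have g2 : i.1 / 2 ^ (t a).1 ≤ (hi a).1 / 2 ^ (t a).1 := Nat.div_le_div_right hi2
    have := ht a
    simp only [Function.Embedding.coeFn_mk, node, Prod.mk.injEq, Fin.mk.injEq, true_and]
    omega

lemma block_lt {l a b : ℕ} (ha : a < l) (hb : b < l) : a * l + b < l * l := by
  have : (a + 1) * l ≤ l * l := Nat.mul_le_mul_right l ha
  nlinarith

/-- transpose map on the first `l*l` positions -/
def transp (l x : ℕ) : ℕ := if x < l * l then (x % l) * l + x / l else x

lemma transp_block {l a b : ℕ} (ha : a < l) (hb : b < l) :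
    transp l (a * l + b) = b * l + a := by
  unfold transp
  rw [if_pos (block_lt ha hb)]
  have h1 : (a * l + b) % l = b := by
    rw [Nat.add_comm, Nat.add_mul_mod_self_right, Nat.mod_eq_of_lt hb]
  have h2 : (a * l + b) / l = a := by
    rw [Nat.add_comm, Nat.add_mul_div_right _ _ (by omega), Nat.div_eq_of_lt hb, zero_add]
  rw [h1, h2]

lemma transp_lt {l k x : ℕ} (hl : l * l ≤ k) (hx : x < k) : transp l x < k := by
  by_cases h : x < l * l
  · have hl0 : 0 < l := by rcases Nat.eq_zero_or_pos l with h0 | h0; · simp [h0] at h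
                           · exact h0
    unfold transp
    rw [if_pos h]
    exact lt_of_lt_of_le (block_lt (Nat.mod_lt _ hl0) (Nat.div_lt_of_lt_mul h)) hl
  · simpa [transp, h] using hx

lemma transp_transp (l x : ℕ) : transp l (transp l x) = x := by
  by_cases h : x < l * l
  · have hl0 : 0 < l := by rcases Nat.eq_zero_or_pos l with h0 | h0; · simp [h0] at h
                           · exact h0
    have e : transp l x = (x % l) * l + x / l := by simp [transp, h]
    rw [e, transp_block (Nat.mod_lt _ hl0) (Nat.div_lt_of_lt_mul h)]
    rw [Nat.mul_comm]; exact Nat.div_add_mod x l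
  · simp [transp, h]

/-- the transposing permutation -/
def tperm (l k : ℕ) (hl : l * l ≤ k) : Equiv.Perm (Fin k) where
  toFun x := ⟨transp l x.1, transp_lt hl x.2⟩
  invFun x := ⟨transp l x.1, transp_lt hl x.2⟩
  left_inv x := by ext; exact transp_transp l x.1
  right_inv x := by ext; exact transp_transp l x.1

lemma lca_of_strictMono {r l k : ℕ} (hl : l * l ≤ k) (ρ : Fin k → Fin (2 ^ r))
    (hρ : StrictMono ρ) :
    ∃ R : Fin l ↪ Fin (r + 1) × Fin (2 ^ r), ∀ a b : Fin l, ∃ t,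
      R a = node t (ρ ⟨a.1 * l + b.1, (block_lt a.2 b.2).trans_le hl⟩) := by
  have hp : ∀ a : Fin l, a.1 * l + 0 < k := fun a =>
    (block_lt a.2 (by have := a.2; omega)).trans_le hl
  have hp' : ∀ a : Fin l, a.1 * l + (l - 1) < k := fun a =>
    (block_lt a.2 (by have := a.2; omega)).trans_le hl
  obtain ⟨R, hR⟩ := lca_family (fun a : Fin l => ρ ⟨a.1 * l + 0, hp a⟩)
    (fun a => ρ ⟨a.1 * l + (l - 1), hp' a⟩)
    (fun a => hρ.monotone (by simp [Fin.le_def]))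
    (fun a b hab => hρ (by
      have h1 : (a.1 + 1) * l ≤ b.1 * l := Nat.mul_le_mul_right l hab
      have := a.2
      rw [Nat.add_mul] at h1
      simp only [Fin.lt_def]
      omega))
  refine ⟨R, fun a b => ?_⟩
  obtain ⟨t, ht⟩ := hR a
  exact ⟨t, ht _ (hρ.monotone (by simp [Fin.le_def]))
    (hρ.monotone (by have := b.2; simp only [Fin.le_def]; omega))⟩

lemma construct (r l k m : ℕ) [NeZero m] (hl : l * l ≤ k) (X : ℝ) (hX : 0 < X)
    (h : X + ((2 : ℝ) ^ r * 2 ^ r) *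
        ((((r + 1 : ℕ) : ℝ) * 2 ^ r) ^ (2 * l) * (1 - 1 / (m : ℝ)) ^ (l * l))
      ≤ ((2 : ℝ) ^ r * 2 ^ r) * (1 - 1 / (m : ℝ)) ^ ((r + 1) * (r + 1))) :
    ∃ M : Fin (2 ^ r) → Fin (2 ^ r) → Bool, X ≤ (mass M : ℝ) ∧ AvoidsPerm M (tperm l k hl) := by
  classical
  let V := Fin (r + 1) × Fin (2 ^ r)
  let S : Fin (2 ^ r) × Fin (2 ^ r) → Finset (V × V) := fun p =>
    (Finset.univ : Finset (Fin (r + 1) × Fin (r + 1))).image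
      (fun s => (node s.1 p.1, node s.2 p.2))
  let B : (Fin l ↪ V) × (Fin l ↪ V) → Finset (V × V) := fun RC =>
    (Finset.univ : Finset (Fin l × Fin l)).map (RC.1.prodMap RC.2)
  have hm1 : (1 : ℝ) ≤ m := by exact_mod_cast (Nat.pos_of_ne_zero (NeZero.ne m))
  have hq0 : (0 : ℝ) ≤ 1 - 1 / (m : ℝ) := by
    rw [sub_nonneg, div_le_one (by linarith)]; exact hm1
  have hcard : Fintype.card ((Fin l ↪ V) × (Fin l ↪ V)) ≤ ((r + 1) * 2 ^ r) ^ (2 * l) := by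
    rw [Fintype.card_prod, two_mul, pow_add]
    have : Fintype.card (Fin l ↪ V) ≤ ((r + 1) * 2 ^ r) ^ l := by
      have := Fintype.card_le_of_injective (fun f : Fin l ↪ V => (f : Fin l → V))
        DFunLike.coe_injective
      simpa [V] using this
    exact Nat.mul_le_mul this this
  obtain ⟨f, hf1, hf2⟩ := prob_exists m S B ((r + 1) * (r + 1)) (l * l)
    (fun p => Finset.card_image_le.trans (by simp)) (fun b => by simp [B]) X hX (by
      refine le_trans ?_ (h.trans (by simp))
      have hc : (Fintype.card ((Fin l ↪ V) × (Fin l ↪ V)) : ℝ)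
          ≤ (((r + 1 : ℕ) : ℝ) * 2 ^ r) ^ (2 * l) := by exact_mod_cast hcard
      have e : (Fintype.card (Fin (2 ^ r) × Fin (2 ^ r)) : ℝ) = (2 : ℝ) ^ r * 2 ^ r := by simp
      rw [e]
      gcongr)
  refine ⟨fun i j => decide (∀ a ∈ S (i, j), f a ≠ 0), ?_, ?_⟩
  · unfold mass
    simpa using hf2
  · rintro ⟨ρ, σ, hρ, hσ, hM⟩
    obtain ⟨R, hR⟩ := lca_of_strictMono hl ρ hρ
    obtain ⟨C, hC⟩ := lca_of_strictMono hl σ hσ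
    obtain ⟨x, hx, hfx⟩ := hf1 (R, C)
    simp only [B, Finset.mem_map, Finset.mem_univ, true_and, Prod.exists] at hx
    obtain ⟨a, b, rfl⟩ := hx
    obtain ⟨s, hs⟩ := hR a b
    obtain ⟨t, ht⟩ := hC b a
    have := hM ⟨a.1 * l + b.1, (block_lt a.2 b.2).trans_le hl⟩
      ⟨b.1 * l + a.1, (block_lt b.2 a.2).trans_le hl⟩ (by
        simp only [permMatrix, decide_eq_true_eq, tperm, Equiv.coe_fn_mk, Fin.mk.injEq]
        exact transp_block a.2 b.2)
    rw [decide_eq_true_eq] at this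
    refine this _ ?_ hfx
    simp only [S, Finset.mem_image, Finset.mem_univ, true_and, Prod.exists]
    exact ⟨s, t, by simp [hs, ht]⟩

lemma q_lower (m : ℕ) (hm : 2 ≤ m) : (1 / 4 : ℝ) ≤ (1 - 1 / (m : ℝ)) ^ m := by
  have hm' : (2 : ℝ) ≤ m := by exact_mod_cast hm
  -- q^m ≥ 1/4: (1-1/m)^(m) = ((1-1/m)^(m/2))^2, Bernoulli in real exponents
  have h0 : (0 : ℝ) ≤ 1 - 1 / (m : ℝ) := by
    rw [sub_nonneg, div_le_one (by linarith)]; linarith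
  have hb := one_add_mul_self_le_rpow_one_add (s := -(1 / (m : ℝ))) (by linarith)
    (p := (m : ℝ) / 2) (by linarith)
  have e1 : 1 + (m : ℝ) / 2 * -(1 / (m : ℝ)) = 1 / 2 := by field_simp; norm_num
  rw [e1, ← sub_eq_add_neg] at hb
  have e2 : ((1 - 1 / (m : ℝ)) ^ ((m : ℝ) / 2)) ^ 2 = (1 - 1 / (m : ℝ)) ^ m := by
    rw [← Real.rpow_natCast, ← Real.rpow_mul h0, ← Real.rpow_natCast]
    congr 1; push_cast; ring
  rw [← e2]
  nlinarith

lemma q_upper (m : ℕ) (hm : 2 ≤ m) : (1 - 1 / (m : ℝ)) ^ m ≤ 1 / 2 := by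
  have hm' : (2 : ℝ) ≤ m := by exact_mod_cast hm
  have h0 : (0 : ℝ) ≤ 1 - 1 / (m : ℝ) := by
    rw [sub_nonneg, div_le_one (by linarith)]; linarith
  have h := Real.one_sub_div_pow_le_exp_neg (n := m) (t := 1) (by linarith)
  refine h.trans ?_
  rw [Real.exp_neg, inv_eq_one_div]
  apply one_div_le_one_div_of_le (by norm_num)
  have := Real.add_one_le_exp (1 : ℝ)
  linarith

lemma numeric (g : ℕ) (hg : 1 ≤ g) :
    (2 : ℝ) ^ (12 * g) + ((2 : ℝ) ^ (8 * g) * 2 ^ (8 * g)) *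
        ((((8 * g + 1 : ℕ) : ℝ) * 2 ^ (8 * g)) ^ (2 * (2916 * g ^ 2)) *
          (1 - 1 / ((81 * g : ℕ) : ℝ)) ^ ((2916 * g ^ 2) * (2916 * g ^ 2)))
      ≤ ((2 : ℝ) ^ (8 * g) * 2 ^ (8 * g)) *
        (1 - 1 / ((81 * g : ℕ) : ℝ)) ^ ((8 * g + 1) * (8 * g + 1)) := by
  have hl := q_lower (81 * g) (by omega)
  have hu := q_upper (81 * g) (by omega)
  have hm' : (1 : ℝ) ≤ ((81 * g : ℕ) : ℝ) := by exact_mod_cast (by omega : 1 ≤ 81 * g)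
  set q : ℝ := 1 - 1 / ((81 * g : ℕ) : ℝ) with hq
  have hq0 : 0 ≤ q := by rw [hq, sub_nonneg, div_le_one (by linarith)]; exact hm'
  have hq1 : q ≤ 1 := by
    rw [hq]; have : 0 ≤ 1 / ((81 * g : ℕ) : ℝ) := by positivity
    linarith
  -- lower bound
  have L : (1 / 2 : ℝ) ^ (2 * g) ≤ q ^ ((8 * g + 1) * (8 * g + 1)) := by
    calc (1 / 2 : ℝ) ^ (2 * g) = (1 / 4 : ℝ) ^ g := by rw [pow_mul]; norm_num
      _ ≤ (q ^ (81 * g)) ^ g := pow_le_pow_left₀ (by norm_num) hl g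
      _ = q ^ (81 * g * g) := by rw [← pow_mul]
      _ ≤ _ := pow_le_pow_of_le_one hq0 hq1 (by nlinarith)
  have U : q ^ ((2916 * g ^ 2) * (2916 * g ^ 2)) ≤ (1 / 2 : ℝ) ^ (36 * g * (2916 * g ^ 2)) := by
    calc q ^ ((2916 * g ^ 2) * (2916 * g ^ 2)) = (q ^ (81 * g)) ^ (36 * g * (2916 * g ^ 2)) := by
          rw [← pow_mul]; congr 1; ring
      _ ≤ _ := pow_le_pow_left₀ (by positivity) hu _
  have hV : (((8 * g + 1 : ℕ) : ℝ) * 2 ^ (8 * g)) ≤ 2 ^ (16 * g) := by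
    have h1 : 8 * g + 1 ≤ 2 ^ (8 * g) := Nat.lt_two_pow_self
    have h2 : ((8 * g + 1 : ℕ) : ℝ) ≤ 2 ^ (8 * g) := by exact_mod_cast h1
    calc _ ≤ (2 : ℝ) ^ (8 * g) * 2 ^ (8 * g) := by gcongr
      _ = _ := by rw [← pow_add]; congr 1; ring
  have W : (((8 * g + 1 : ℕ) : ℝ) * 2 ^ (8 * g)) ^ (2 * (2916 * g ^ 2)) *
      q ^ ((2916 * g ^ 2) * (2916 * g ^ 2)) ≤ (1 / 2 : ℝ) ^ (4 * g) := by
    calc _ ≤ ((2 : ℝ) ^ (16 * g)) ^ (2 * (2916 * g ^ 2)) * (1 / 2 : ℝ) ^ (36 * g * (2916 * g ^ 2)) := by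
          gcongr
      _ = (2 : ℝ) ^ (32 * g * (2916 * g ^ 2)) * ((1 / 2 : ℝ) ^ (32 * g * (2916 * g ^ 2)) *
            (1 / 2 : ℝ) ^ (4 * g * (2916 * g ^ 2))) := by
          rw [← pow_mul, ← pow_add]; congr 2 <;> ring
      _ = (1 / 2 : ℝ) ^ (4 * g * (2916 * g ^ 2)) := by
          rw [← mul_assoc, ← mul_pow]; norm_num
      _ ≤ _ := pow_le_pow_of_le_one (by norm_num) (by norm_num)
          (Nat.le_mul_of_pos_right _ (by positivity))
  have hA : (0 : ℝ) ≤ (2 : ℝ) ^ (8 * g) * 2 ^ (8 * g) := by positivity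
  have e12 : (2 : ℝ) ^ (12 * g) = ((2 : ℝ) ^ (8 * g) * 2 ^ (8 * g)) * (1 / 2 : ℝ) ^ (4 * g) := by
    rw [← pow_add, show 8 * g + 8 * g = 12 * g + 4 * g by ring, pow_add, mul_assoc, ← mul_pow]
    norm_num
  have L2 : (1 / 2 : ℝ) ^ (4 * g) + (1 / 2 : ℝ) ^ (4 * g) ≤ (1 / 2 : ℝ) ^ (2 * g) := by
    calc (1 / 2 : ℝ) ^ (4 * g) + (1 / 2 : ℝ) ^ (4 * g)
        = 2 * ((1 / 2 : ℝ) ^ (2 * g) * (1 / 2 : ℝ) ^ (2 * g)) := by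
          rw [← pow_add, ← two_mul]; congr 2; ring
      _ ≤ 2 * ((1 / 2 : ℝ) ^ (2 * g) * (1 / 2 : ℝ) ^ 1) := by
          gcongr 2 * (_ * ?_)
          exact pow_le_pow_of_le_one (by norm_num) (by norm_num) (by omega)
      _ = _ := by ring
  rw [e12]
  have := mul_le_mul_of_nonneg_left W hA
  have := mul_le_mul_of_nonneg_left L hA
  have := mul_le_mul_of_nonneg_left L2 hA
  linarith

theorem stmt7 :
    ∃ c : ℝ, 0 < c ∧ ∀ k : ℕ, 2 < k →
      ∃ (π : Equiv.Perm (Fin k)) (N : ℕ), 0 < N ∧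
        (2 : ℝ) ^ (c * (k : ℝ) ^ ((1 : ℝ) / 4)) ≤ (N : ℝ) ∧
        ∃ M : Fin N → Fin N → Bool,
          (N : ℝ) ^ ((3 : ℝ) / 2) ≤ (mass M : ℝ) ∧ AvoidsPerm M π := by
  refine ⟨1 / 54, by norm_num, fun k hk => ?_⟩
  set x : ℝ := (k : ℝ) ^ ((1 : ℝ) / 4) with hx
  have hx0 : 0 ≤ x := by positivity
  have hx4 : x ^ 4 = k := by
    rw [hx, ← Real.rpow_natCast, ← Real.rpow_mul (by positivity)]
    norm_num
  set g : ℕ := ⌊1 / 54 * x⌋₊ with hg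
  have hlt : 1 / 54 * x < g + 1 := Nat.lt_floor_add_one _
  have hle : (g : ℝ) ≤ 1 / 54 * x := Nat.floor_le (by positivity)
  rcases Nat.eq_zero_or_pos g with h0 | h0
  · refine ⟨1, 2, by norm_num, ?_, fun _ _ => true, ?_, ?_⟩
    · rw [h0] at hlt
      calc (2 : ℝ) ^ (1 / 54 * x) ≤ 2 ^ (1 : ℝ) :=
            Real.rpow_le_rpow_of_exponent_le (by norm_num) (by push_cast at hlt; linarith)
        _ = _ := by norm_num
    · have : mass (fun _ _ => true : Fin 2 → Fin 2 → Bool) = 4 := by simp [mass]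
      rw [this]
      calc ((2 : ℕ) : ℝ) ^ ((3 : ℝ) / 2) ≤ ((2 : ℕ) : ℝ) ^ (2 : ℝ) :=
            Real.rpow_le_rpow_of_exponent_le (by norm_num) (by norm_num)
        _ = _ := by norm_num
    · rintro ⟨ρ, -, hρ, -⟩
      have := Fintype.card_le_of_injective ρ hρ.injective
      simp at this
      omega
  · have hl : (2916 * g ^ 2) * (2916 * g ^ 2) ≤ k := by
      have h1 : ((54 * g : ℝ)) ^ 4 ≤ x ^ 4 :=
        pow_le_pow_left₀ (by positivity) (by linarith) 4
      rw [hx4] at h1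
      have h2 : (54 * g) ^ 4 ≤ k := by exact_mod_cast h1
      calc _ = (54 * g) ^ 4 := by ring
        _ ≤ k := h2
    haveI : NeZero (81 * g) := ⟨by omega⟩
    obtain ⟨M, hM, hA⟩ := construct (8 * g) (2916 * g ^ 2) k (81 * g) hl (2 ^ (12 * g))
      (by positivity) (numeric g h0)
    refine ⟨tperm _ k hl, 2 ^ (8 * g), by positivity, ?_, M, ?_, hA⟩
    · have hg1 : (1 : ℝ) ≤ g := by exact_mod_cast h0
      calc (2 : ℝ) ^ (1 / 54 * x) ≤ 2 ^ ((8 * g : ℕ) : ℝ) :=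
            Real.rpow_le_rpow_of_exponent_le (by norm_num) (by push_cast; linarith)
        _ = _ := by rw [Real.rpow_natCast]; push_cast; rfl
    · refine le_trans (le_of_eq ?_) hM
      push_cast
      rw [← Real.rpow_natCast, ← Real.rpow_mul (by norm_num), ← Real.rpow_natCast]
      congr 1; push_cast; ring
end
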